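/- arXiv:1908.09325 — 2 statements merged into one kernel-verified Lean document; each statement's English description precedes it below -/
import Mathlib

section
/- Let M be a feasible irreducible connection k-pattern that decomposes into three sequential swaps M[X], M[Y], M[Z] with |X| = |Y| = 2. If there is exactly one index i ∈ [k−1] with (i ∈ X and i+1 ∈ Y) or (i ∈ Y and i+1 ∈ X), then the connection pattern M' obtained from M by swapping i and i+1 is either feasible or reducible. -/
/-!  Connection patterns for `k`-opt swaps (1-indexed: deleted edges are indexed by
`[k] = Finset.Icc 1 k`, pattern vertices `2i-1` and `2i` are the left and right endpoints
of the `i`-th deleted edge). -/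

/-- The pattern vertices corresponding to an index set `X ⊆ [k]`:
`{2i−1, 2i : i ∈ X}`. -/
def pvs (X : Finset ℕ) : Finset ℕ := X.biUnion fun i => {2 * i - 1, 2 * i}

/-- `N` is a perfect matching on the vertex set `S`: its edges are loopless, lie inside
`S`, and every vertex of `S` is on exactly one edge of `N`. -/
def IsMatchingOn (N : Finset (Sym2 ℕ)) (S : Finset ℕ) : Prop :=
  (∀ e ∈ N, ¬ e.IsDiag) ∧ (∀ e ∈ N, ∀ v ∈ e, v ∈ S) ∧
  (∀ v ∈ S, ∃! e, e ∈ N ∧ v ∈ e)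

/-- The cyclic successor of `i` in the finite set `X`. -/
noncomputable def nextIn (X : Finset ℕ) (i : ℕ) : ℕ :=
  if h : (X.filter fun j => i < j).Nonempty then (X.filter fun j => i < j).min' h
  else if h' : X.Nonempty then X.min' h' else 0

/-- The "segment" edges of an index set `X`: for each `i ∈ X`, joining the right endpoint
`2i` of the `i`-th deleted edge to the left endpoint `2·nextIn X i − 1` of the cyclically
next deleted edge (representing the path of the Hamiltonian cycle between them). -/
noncomputable def segEdges (X : Finset ℕ) : Finset (Sym2 ℕ) :=
  X.image fun i => s(2 * i, 2 * nextIn X i - 1)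

/-- The sub-pattern `M[X]` of `M`: the edges of `M` lying inside `{2i−1, 2i : i ∈ X}`. -/
def subPat (M : Finset (Sym2 ℕ)) (X : Finset ℕ) : Finset (Sym2 ℕ) :=
  M.filter fun e => e ∈ (pvs X).sym2

/-- The connection pattern `N` on index set `X` is feasible: a swap fitting into it turns
a Hamiltonian cycle into a single Hamiltonian cycle again.  Intrinsically: the (2-regular)
graph on `{2i−1, 2i : i ∈ X}` consisting of the matching `N` together with the segment
edges of `X` is a single cycle, i.e. connected. -/
def FeasiblePat (N : Finset (Sym2 ℕ)) (X : Finset ℕ) : Prop :=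
  ∀ u ∈ pvs X, ∀ v ∈ pvs X,
    (SimpleGraph.fromEdgeSet ((N ∪ segEdges X : Finset (Sym2 ℕ)) : Set (Sym2 ℕ))).Reachable u v

/-- The connection pattern `N` on index set `X` is sequential:
`N ∪ {{2i−1, 2i} : i ∈ X}` forms a single (simple) cycle. -/
def SequentialPat (N : Finset (Sym2 ℕ)) (X : Finset ℕ) : Prop :=
  ∀ u ∈ pvs X, ∀ v ∈ pvs X,
    (SimpleGraph.fromEdgeSet
      ((N ∪ X.image fun i => s(2 * i - 1, 2 * i) : Finset (Sym2 ℕ)) : Set (Sym2 ℕ))).Reachable u v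

/-- A connection `k`-pattern `M` is reducible if it decomposes into two feasible patterns
(two moves). -/
def Reducible (M : Finset (Sym2 ℕ)) (k : ℕ) : Prop :=
  ∃ X Y : Finset ℕ, X ∪ Y = Finset.Icc 1 k ∧ Disjoint X Y ∧ X.Nonempty ∧ Y.Nonempty ∧
    IsMatchingOn (subPat M X) (pvs X) ∧ IsMatchingOn (subPat M Y) (pvs Y) ∧
    FeasiblePat (subPat M X) X ∧ FeasiblePat (subPat M Y) Y

/-- The number of interactions between index sets `X` and `Y` inside `[k]`. -/
def numInteractions (k : ℕ) (X Y : Finset ℕ) : ℕ :=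
  ((Finset.Icc 1 (k - 1)).filter fun i =>
    (i ∈ X ∧ i + 1 ∈ Y) ∨ (i ∈ Y ∧ i + 1 ∈ X)).card

/-- The pattern obtained from `M` by swapping `i` and `i+1`: exchange the matching
partners of `2i−1` and `2i+1`, and exchange the matching partners of `2i` and `2i+2`. -/
def swapAdjPat (M : Finset (Sym2 ℕ)) (i : ℕ) : Finset (Sym2 ℕ) :=
  M.image (Sym2.map fun m => Equiv.swap (2 * i - 1) (2 * i + 1) (Equiv.swap (2 * i) (2 * i + 2) m))

/-- Relabel so that the two ends of `e` carry the same label. -/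
def mergeLabels (f : Fin 8 → Fin 8) (e : Fin 8 × Fin 8) : Fin 8 → Fin 8 :=
  fun x => if f x = f e.1 then f e.2 else f x

/-- The partition of `Fin 8` into the fibres of `f`, coarsened by the edges in `E`, is trivial. -/
def LabelsConnected (f : Fin 8 → Fin 8) (E : List (Fin 8 × Fin 8)) : Prop :=
  ∀ x, E.foldl mergeLabels f x = E.foldl mergeLabels f 0

instance (f : Fin 8 → Fin 8) (E : List (Fin 8 × Fin 8)) : Decidable (LabelsConnected f E) :=
  inferInstanceAs (Decidable (∀ _, _))

/-- The two matchings of `{x, x'}` with `{y, y'}`. -/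
def pairEdges (x x' y y' : Fin 8) (c : Bool) : List (Fin 8 × Fin 8) :=
  if c then [(x, y), (x', y')] else [(x, y'), (x', y)]

/-- The segments joining four deleted edges, in the two possible cyclic orders. -/
def segLabels (o : Bool) : Fin 8 → Fin 8 :=
  if o then ![0, 1, 1, 3, 3, 5, 5, 0] else ![0, 1, 1, 3, 4, 0, 3, 4]

/-- The case analysis for the label function `f` and the cyclic order `o`. -/
def LabelsCase (f : Fin 8 → Fin 8) : Prop :=
  (∀ c, Even (Finset.univ.filter fun x => f x = c).card) →
  ∀ o cX cY : Bool,
    LabelsConnected f (pairEdges 0 1 4 5 cX ++ pairEdges 2 3 6 7 cY) →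
    ¬ (cX = true ∧ LabelsConnected f (pairEdges 2 3 6 7 cY ++ [(0, 1), (4, 5)])) →
    ¬ (cY = true ∧ LabelsConnected f (pairEdges 0 1 4 5 cX ++ [(2, 3), (6, 7)])) →
    ¬ (LabelsConnected (segLabels o) (pairEdges 0 1 4 5 cX ++ pairEdges 2 3 6 7 cY) ∧
      LabelsConnected f [(0, 1), (2, 3), (4, 5), (6, 7)]) →
    LabelsConnected f (pairEdges 2 3 4 5 cX ++ pairEdges 0 1 6 7 cY) ∨
    (LabelsConnected (segLabels o) (pairEdges 2 3 4 5 cX ++ pairEdges 0 1 6 7 cY) ∧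
      LabelsConnected f [(0, 1), (2, 3), (4, 5), (6, 7)])

instance (f : Fin 8 → Fin 8) : Decidable (LabelsCase f) :=
  inferInstanceAs (Decidable (_ → ∀ _, _))

lemma labelsCase_vec :
    ∀ f3 ∈ [0, 3], ∀ f4 ∈ [0, 3, 4], ∀ f5 ∈ [0, 3, 4, 5], ∀ f6 ∈ [0, 3, 4, 5, 6],
    ∀ f7 ∈ [0, 3, 4, 5, 6, 7], LabelsCase ![0, 1, 1, f3, f4, f5, f6, f7] := by
  decide +kernel

lemma apply_mergeLabels_eq {f : Fin 8 → Fin 8} {x y : Fin 8} (e : Fin 8 × Fin 8)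
    (h : f x = f y) : mergeLabels f e x = mergeLabels f e y := by
  simp [mergeLabels, h]

lemma apply_foldl_mergeLabels_eq (E : List (Fin 8 × Fin 8)) {f : Fin 8 → Fin 8} {x y : Fin 8}
    (h : f x = f y) : E.foldl mergeLabels f x = E.foldl mergeLabels f y := by
  induction E generalizing f with
  | nil => exact h
  | cons e E ih => exact ih (apply_mergeLabels_eq e h)

lemma foldl_mergeLabels_edge_eq {E : List (Fin 8 × Fin 8)} (f : Fin 8 → Fin 8)
    {e : Fin 8 × Fin 8} (he : e ∈ E) :
    E.foldl mergeLabels f e.1 = E.foldl mergeLabels f e.2 := by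
  induction E generalizing f with
  | nil => simp at he
  | cons d E ih =>
    rcases List.mem_cons.1 he with rfl | he
    · exact apply_foldl_mergeLabels_eq E (by simp [mergeLabels])
    · exact ih _ he

/-- A trivial merged partition forces every compatible equivalence relation to be trivial. -/
lemma LabelsConnected.rel {f : Fin 8 → Fin 8} {E : List (Fin 8 × Fin 8)}
    (h : LabelsConnected f E) {r : Fin 8 → Fin 8 → Prop} (hr : Equivalence r)
    (hf : ∀ x y, f x = f y → r x y) (hE : ∀ e ∈ E, r e.1 e.2) (x y : Fin 8) : r x y := by
  have key : ∀ x y, E.foldl mergeLabels f x = E.foldl mergeLabels f y → r x y := by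
    clear h
    induction E generalizing f with
    | nil => exact hf
    | cons e E ih =>
      refine ih (fun x y hxy => ?_) fun d hd => hE d (List.mem_cons_of_mem _ hd)
      have he := hE e List.mem_cons_self
      unfold mergeLabels at hxy
      split_ifs at hxy with h1 h2 h2
      · exact hf _ _ (h1.trans h2.symm)
      · exact hr.trans (hf _ _ h1) (hr.trans he (hf _ _ hxy))
      · exact hr.trans (hf _ _ hxy) (hr.symm (hr.trans (hf _ _ h2) he))
      · exact hf _ _ hxy
  exact key x y ((h x).trans (h y).symm)

/-- The graph on `ℕ` with edge set `E`. -/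
abbrev edgeGraph (E : Finset (Sym2 ℕ)) : SimpleGraph ℕ :=
  SimpleGraph.fromEdgeSet (E : Set (Sym2 ℕ))

lemma reachable_of_mem {E : Finset (Sym2 ℕ)} {a b : ℕ} (h : s(a, b) ∈ E) :
    (edgeGraph E).Reachable a b := by
  by_cases hab : a = b
  · rw [hab]
  · exact SimpleGraph.Adj.reachable (by simpa [hab] using h)

lemma reachable_mono {E F : Finset (Sym2 ℕ)} (h : E ⊆ F) {a b : ℕ}
    (hab : (edgeGraph E).Reachable a b) : (edgeGraph F).Reachable a b :=
  hab.mono (SimpleGraph.fromEdgeSet_mono (by exact_mod_cast h))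

lemma reachable_equivalence (E : Finset (Sym2 ℕ)) (t : Fin 8 → ℕ) :
    Equivalence fun x y => (edgeGraph E).Reachable (t x) (t y) :=
  ⟨fun _ => .refl _, .symm, .trans⟩

/-- A predicate that propagates along edges propagates along reachability. -/
lemma of_reachable {E : Finset (Sym2 ℕ)} {P : ℕ → Prop}
    (hP : ∀ a b, s(a, b) ∈ E → P a → P b) {u v : ℕ}
    (h : (edgeGraph E).Reachable u v) (hu : P u) : P v := by
  obtain ⟨w⟩ := h
  induction w with
  | nil => exact hu
  | cons hadj _ ih =>
    rw [SimpleGraph.fromEdgeSet_adj] at hadj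
    exact ih (hP _ _ (by exact_mod_cast hadj.1) hu)

lemma mem_pvs {S : Finset ℕ} {v : ℕ} : v ∈ pvs S ↔ (v + 1) / 2 ∈ S := by
  simp only [pvs, Finset.mem_biUnion, Finset.mem_insert, Finset.mem_singleton]
  constructor
  · rintro ⟨j, hj, h | h⟩
    · rwa [show (v + 1) / 2 = j by omega]
    · rwa [show (v + 1) / 2 = j by omega]
  · exact fun h => ⟨_, h, by omega⟩

lemma pvs_union (S T : Finset ℕ) : pvs (S ∪ T) = pvs S ∪ pvs T := by
  ext v
  simp [mem_pvs]

lemma mem_subPat {M : Finset (Sym2 ℕ)} {S : Finset ℕ} {a b : ℕ} :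
    s(a, b) ∈ subPat M S ↔ s(a, b) ∈ M ∧ a ∈ pvs S ∧ b ∈ pvs S := by
  simp [subPat]

lemma subPat_subset (M : Finset (Sym2 ℕ)) (S : Finset ℕ) : subPat M S ⊆ M :=
  Finset.filter_subset _ _

lemma FeasiblePat.mono {N N' : Finset (Sym2 ℕ)} {S : Finset ℕ} (h : FeasiblePat N S)
    (hN : N ⊆ N') : FeasiblePat N' S :=
  fun u hu v hv => reachable_mono (Finset.union_subset_union_left hN) (h u hu v hv)

lemma nextIn_eq_of_lt {S : Finset ℕ} {i j : ℕ} (hj : j ∈ S) (hij : i < j)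
    (h : ∀ l ∈ S, i < l → j ≤ l) : nextIn S i = j := by
  have hne : (S.filter fun l => i < l).Nonempty := ⟨j, by simp [hj, hij]⟩
  rw [nextIn, dif_pos hne]
  refine le_antisymm (Finset.min'_le _ _ (by simp [hj, hij])) (Finset.le_min' _ _ _ fun l hl => ?_)
  simp only [Finset.mem_filter] at hl
  exact h l hl.1 hl.2

lemma nextIn_eq_of_wrap {S : Finset ℕ} {i j : ℕ} (hj : j ∈ S) (hi : ∀ l ∈ S, l ≤ i)
    (h : ∀ l ∈ S, j ≤ l) : nextIn S i = j := by
  have hne : ¬ (S.filter fun l => i < l).Nonempty := by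
    simpa [Finset.filter_nonempty_iff] using hi
  rw [nextIn, dif_neg hne, dif_pos ⟨j, hj⟩]
  exact le_antisymm (Finset.min'_le _ _ hj) (Finset.le_min' _ _ _ h)

lemma nextIn_mem {S : Finset ℕ} (hS : S.Nonempty) (i : ℕ) : nextIn S i ∈ S := by
  unfold nextIn
  split_ifs with h
  · exact (Finset.mem_filter.1 (Finset.min'_mem _ h)).1
  · exact Finset.min'_mem _ hS

lemma nextIn_Icc {k j : ℕ} (hj : j ∈ Finset.Icc 1 k) :
    nextIn (Finset.Icc 1 k) j = if j = k then 1 else j + 1 := by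
  rw [Finset.mem_Icc] at hj
  split_ifs with h
  · refine nextIn_eq_of_wrap (Finset.mem_Icc.2 ⟨le_rfl, by omega⟩) ?_ ?_ <;>
      (intro l hl; rw [Finset.mem_Icc] at hl; omega)
  · exact nextIn_eq_of_lt (Finset.mem_Icc.2 ⟨by omega, by omega⟩) (by omega) fun l _ h => h

lemma nextIn_of_nextIn_Icc_mem {k j : ℕ} {S : Finset ℕ} (hS : S ⊆ Finset.Icc 1 k)
    (hj : j ∈ Finset.Icc 1 k) (h : nextIn (Finset.Icc 1 k) j ∈ S) :
    nextIn S j = nextIn (Finset.Icc 1 k) j := by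
  rw [nextIn_Icc hj] at h ⊢
  split_ifs at h ⊢ with hjk
  · exact nextIn_eq_of_wrap h (fun l hl => hjk ▸ (Finset.mem_Icc.1 (hS hl)).2)
      fun l hl => (Finset.mem_Icc.1 (hS hl)).1
  · exact nextIn_eq_of_lt h (by omega) fun l _ h => h

lemma nextIn_of_nextIn_Icc_notMem {k j : ℕ} {S : Finset ℕ} (hS : S ⊆ Finset.Icc 1 k)
    (hne : S.Nonempty) (hj : j ∈ Finset.Icc 1 k) (h : nextIn (Finset.Icc 1 k) j ∉ S) :
    nextIn S (nextIn (Finset.Icc 1 k) j) = nextIn S j := by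
  rw [nextIn_Icc hj] at h ⊢
  split_ifs at h ⊢ with hjk
  · have h1 : ∀ l ∈ S, 1 < l := fun l hl => by
      have := (Finset.mem_Icc.1 (hS hl)).1
      have : l ≠ 1 := by rintro rfl; exact h hl
      omega
    rw [nextIn_eq_of_lt (Finset.min'_mem S hne) (h1 _ (Finset.min'_mem S hne))
      fun l hl _ => Finset.min'_le _ _ hl]
    exact (nextIn_eq_of_wrap (Finset.min'_mem S hne)
      (fun l hl => hjk ▸ (Finset.mem_Icc.1 (hS hl)).2) fun l hl => Finset.min'_le _ _ hl).symm
  · have : (S.filter fun l => j + 1 < l) = S.filter fun l => j < l := by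
      ext l
      simp only [Finset.mem_filter, and_congr_right_iff]
      intro hl
      have : l ≠ j + 1 := by rintro rfl; exact h hl
      omega
    simp only [nextIn, this]

lemma seg_mem {S : Finset ℕ} {i j : ℕ} (hi : i ∈ S) (h : nextIn S i = j) :
    s(2 * i, 2 * j - 1) ∈ segEdges S :=
  Finset.mem_image.2 ⟨i, hi, by rw [h]⟩

/-- Contracting the deleted edges outside `S` turns connectedness over `[k]` into feasibility
on `S`. -/
lemma feasiblePat_of_contract {k : ℕ} {S : Finset ℕ} {N : Finset (Sym2 ℕ)}
    (hS : S ⊆ Finset.Icc 1 k) (hne : S.Nonempty)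
    (hN : ∀ a b, s(a, b) ∈ N → a ∈ pvs S ∧ b ∈ pvs S)
    (h : ∀ u ∈ pvs S, ∀ v ∈ pvs S, (edgeGraph (N ∪ segEdges (Finset.Icc 1 k) ∪
      (Finset.Icc 1 k \ S).image fun j => s(2 * j - 1, 2 * j))).Reachable u v) :
    FeasiblePat N S := by
  intro u hu v hv
  set φ : ℕ → ℕ := fun v => if (v + 1) / 2 ∈ S then v else 2 * nextIn S ((v + 1) / 2) - 1 with hφ
  have hmem : ∀ v, v ∈ pvs S → φ v = v := fun v hv => if_pos (mem_pvs.1 hv)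
  have hright : ∀ j ∈ S, φ (2 * j) = 2 * j := fun j hj => hmem _ (mem_pvs.2 (by
    rwa [show (2 * j + 1) / 2 = j by omega]))
  have hright' : ∀ j ∉ S, φ (2 * j) = 2 * nextIn S j - 1 := fun j hj => by
    simp only [hφ, show (2 * j + 1) / 2 = j by omega, hj, if_false]
  have hleft : ∀ j, 1 ≤ j → j ∈ S → φ (2 * j - 1) = 2 * j - 1 := fun j h1 hj =>
    hmem _ (mem_pvs.2 (by rwa [show (2 * j - 1 + 1) / 2 = j by omega]))
  have hleft' : ∀ j, 1 ≤ j → j ∉ S → φ (2 * j - 1) = 2 * nextIn S j - 1 := fun j h1 hj => by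
    simp only [hφ, show (2 * j - 1 + 1) / 2 = j by omega, hj, if_false]
  have hIcc : (Finset.Icc 1 k).Nonempty := hne.mono hS
  have hseg : ∀ j ∈ Finset.Icc 1 k, (edgeGraph (N ∪ segEdges S)).Reachable (φ (2 * j))
      (φ (2 * nextIn (Finset.Icc 1 k) j - 1)) := by
    intro j hj
    have hn := nextIn_mem hIcc j
    have hend : φ (2 * nextIn (Finset.Icc 1 k) j - 1) = 2 * nextIn S j - 1 := by
      by_cases hnS : nextIn (Finset.Icc 1 k) j ∈ S
      · rw [hleft _ (Finset.mem_Icc.1 hn).1 hnS, nextIn_of_nextIn_Icc_mem hS hj hnS]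
      · rw [hleft' _ (Finset.mem_Icc.1 hn).1 hnS, nextIn_of_nextIn_Icc_notMem hS hne hj hnS]
    rw [hend]
    by_cases hjS : j ∈ S
    · rw [hright j hjS]
      exact reachable_of_mem (Finset.mem_union_right _ (seg_mem hjS rfl))
    · rw [hright' j hjS]
  have key : (edgeGraph (N ∪ segEdges S)).Reachable (φ u) (φ v) := by
    refine of_reachable (P := fun x => (edgeGraph (N ∪ segEdges S)).Reachable (φ u) (φ x))
      (fun a b hab ha => ha.trans ?_) (h u hu v hv) (.refl _)
    rcases Finset.mem_union.1 hab with hab | hab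
    · rcases Finset.mem_union.1 hab with hab | hab
      · rw [hmem a (hN a b hab).1, hmem b (hN a b hab).2]
        exact reachable_of_mem (Finset.mem_union_left _ hab)
      · obtain ⟨j, hj, he⟩ := Finset.mem_image.1 hab
        rcases Sym2.eq_iff.1 he with ⟨rfl, rfl⟩ | ⟨rfl, rfl⟩
        · exact hseg j hj
        · exact (hseg j hj).symm
    · obtain ⟨j, hj, he⟩ := Finset.mem_image.1 hab
      obtain ⟨hj, hjS⟩ := Finset.mem_sdiff.1 hj
      have h1 := (Finset.mem_Icc.1 hj).1
      rcases Sym2.eq_iff.1 he with ⟨rfl, rfl⟩ | ⟨rfl, rfl⟩ <;>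
        rw [hleft' j h1 hjS, hright' j hjS]
  rwa [hmem u hu, hmem v hv] at key

lemma even_card_of_involution {C : Finset ℕ} (g : ℕ → ℕ) (hg : ∀ v ∈ C, g v ∈ C)
    (hne : ∀ v ∈ C, g v ≠ v) (hgg : ∀ v ∈ C, g (g v) = v) : Even C.card := by
  have h : ∑ _v ∈ C, (1 : ZMod 2) = 0 :=
    Finset.sum_involution (fun v _ => g v) (fun _ _ => by decide) (fun v hv _ => hne v hv) hg hgg
  rw [Finset.sum_const, nsmul_eq_mul, mul_one] at h
  exact (ZMod.natCast_eq_zero_iff_even).1 h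

lemma IsMatchingOn.eq_of_mem {N : Finset (Sym2 ℕ)} {S : Finset ℕ} (h : IsMatchingOn N S)
    {a b c : ℕ} (hb : s(a, b) ∈ N) (hc : s(a, c) ∈ N) : b = c := by
  have ha : a ∈ S := h.2.1 _ hb a (Sym2.mem_mk_left _ _)
  have := (h.2.2 a ha).unique ⟨hb, Sym2.mem_mk_left _ _⟩ ⟨hc, Sym2.mem_mk_left _ _⟩
  exact Sym2.congr_right.1 this

lemma IsMatchingOn.exists_mem {N : Finset (Sym2 ℕ)} {S : Finset ℕ} (h : IsMatchingOn N S)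
    {a : ℕ} (ha : a ∈ S) : ∃ b, s(a, b) ∈ N ∧ b ∈ S ∧ b ≠ a := by
  obtain ⟨e, ⟨he, hae⟩, -⟩ := h.2.2 a ha
  obtain ⟨b, rfl⟩ := Sym2.mem_iff_exists.1 hae
  exact ⟨b, he, h.2.1 _ he b (Sym2.mem_mk_right _ _), fun hba => h.1 _ he (by simp [hba])⟩

lemma IsMatchingOn.even_card {N : Finset (Sym2 ℕ)} {S C : Finset ℕ} (h : IsMatchingOn N S)
    (hC : C ⊆ S) (hcl : ∀ a b, s(a, b) ∈ N → a ∈ C → b ∈ C) : Even C.card := by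
  have hex : ∀ a, ∃ b, a ∈ S → s(a, b) ∈ N ∧ b ≠ a := fun a => by
    by_cases ha : a ∈ S
    · obtain ⟨b, hb, -, hba⟩ := h.exists_mem ha
      exact ⟨b, fun _ => ⟨hb, hba⟩⟩
    · exact ⟨0, fun h => absurd h ha⟩
  choose g hg using hex
  have hgC : ∀ v ∈ C, g v ∈ C := fun v hv => hcl _ _ (hg v (hC hv)).1 hv
  refine even_card_of_involution g hgC (fun v hv => (hg v (hC hv)).2) fun v hv => ?_
  refine h.eq_of_mem (hg _ (hC (hgC v hv))).1 ?_
  rw [Sym2.eq_swap]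
  exact (hg v (hC hv)).1

lemma isMatchingOn_subPat {M : Finset (Sym2 ℕ)} {K S : Finset ℕ} (hM : IsMatchingOn M (pvs K))
    (hS : S ⊆ K) (h : ∀ a ∈ pvs S, ∃ b ∈ pvs S, s(a, b) ∈ M) :
    IsMatchingOn (subPat M S) (pvs S) := by
  refine ⟨fun e he => hM.1 e (subPat_subset _ _ he), fun e he v hv => ?_, fun a ha => ?_⟩
  · exact Finset.mem_sym2_iff.1 (Finset.mem_filter.1 he).2 v hv
  · obtain ⟨b, hb, hab⟩ := h a ha
    refine ⟨s(a, b), ⟨mem_subPat.2 ⟨hab, ha, hb⟩, Sym2.mem_mk_left _ _⟩, fun e ⟨he, hae⟩ => ?_⟩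
    exact (hM.2.2 a (mem_pvs.2 (hS (mem_pvs.1 ha)))).unique ⟨subPat_subset _ _ he, hae⟩
      ⟨hab, Sym2.mem_mk_left _ _⟩

lemma isMatchingOn_subPat_union {M : Finset (Sym2 ℕ)} {K S T : Finset ℕ}
    (hM : IsMatchingOn M (pvs K)) (hST : S ∪ T ⊆ K) (hS : IsMatchingOn (subPat M S) (pvs S))
    (hT : IsMatchingOn (subPat M T) (pvs T)) :
    IsMatchingOn (subPat M (S ∪ T)) (pvs (S ∪ T)) := by
  refine isMatchingOn_subPat hM hST fun a ha => ?_
  rw [pvs_union] at ha ⊢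
  rcases Finset.mem_union.1 ha with ha | ha
  · obtain ⟨b, hab, hb, -⟩ := hS.exists_mem ha
    exact ⟨b, Finset.mem_union_left _ hb, subPat_subset _ _ hab⟩
  · obtain ⟨b, hab, hb, -⟩ := hT.exists_mem ha
    exact ⟨b, Finset.mem_union_right _ hb, subPat_subset _ _ hab⟩

lemma subPat_image {M : Finset (Sym2 ℕ)} {S : Finset ℕ} (π : Equiv.Perm ℕ)
    (hπ : ∀ v, π v ∈ pvs S ↔ v ∈ pvs S) :
    subPat (M.image (Sym2.map π)) S = (subPat M S).image (Sym2.map π) := by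
  ext e
  induction e using Sym2.ind with
  | _ a b =>
  simp only [mem_subPat, Finset.mem_image]
  constructor
  · rintro ⟨⟨e, he, heq⟩, ha, hb⟩
    refine ⟨e, ?_, heq⟩
    induction e using Sym2.ind with
    | _ c d =>
    rw [mem_subPat]
    rcases Sym2.eq_iff.1 ((Sym2.map_mk _ _ _).symm.trans heq) with ⟨rfl, rfl⟩ | ⟨rfl, rfl⟩
    · exact ⟨he, (hπ _).1 ha, (hπ _).1 hb⟩
    · exact ⟨he, (hπ _).1 hb, (hπ _).1 ha⟩
  · rintro ⟨e, he, heq⟩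
    induction e using Sym2.ind with
    | _ c d =>
    rw [mem_subPat] at he
    refine ⟨⟨_, he.1, heq⟩, ?_⟩
    rcases Sym2.eq_iff.1 ((Sym2.map_mk _ _ _).symm.trans heq) with ⟨rfl, rfl⟩ | ⟨rfl, rfl⟩
    · exact ⟨(hπ _).2 he.2.1, (hπ _).2 he.2.2⟩
    · exact ⟨(hπ _).2 he.2.2, (hπ _).2 he.2.1⟩

lemma IsMatchingOn.image {N : Finset (Sym2 ℕ)} {S : Finset ℕ} (h : IsMatchingOn N S)
    (π : Equiv.Perm ℕ) (hπ : ∀ v, π v ∈ S ↔ v ∈ S) : IsMatchingOn (N.image (Sym2.map π)) S := by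
  refine ⟨fun e he => ?_, fun e he v hv => ?_, fun v hv => ?_⟩
  · obtain ⟨d, hd, rfl⟩ := Finset.mem_image.1 he
    rw [Sym2.isDiag_map π.injective]
    exact h.1 d hd
  · obtain ⟨d, hd, rfl⟩ := Finset.mem_image.1 he
    obtain ⟨w, hw, rfl⟩ := Sym2.mem_map.1 hv
    exact (hπ w).2 (h.2.1 d hd w hw)
  · obtain ⟨w, rfl⟩ := π.surjective v
    obtain ⟨e, ⟨he, hwe⟩, huniq⟩ := h.2.2 w ((hπ w).1 hv)
    refine ⟨e.map π, ⟨Finset.mem_image_of_mem _ he, Sym2.mem_map.2 ⟨w, hwe, rfl⟩⟩, ?_⟩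
    rintro e' ⟨he', hve'⟩
    obtain ⟨d, hd, rfl⟩ := Finset.mem_image.1 he'
    obtain ⟨w', hw', hww⟩ := Sym2.mem_map.1 hve'
    rw [huniq d ⟨hd, π.injective hww ▸ hw'⟩]

lemma seg_Icc_cases {k u v : ℕ} (h : s(u, v) ∈ segEdges (Finset.Icc 1 k)) :
    ∃ j, 1 ≤ j ∧ j ≤ k ∧ ∃ n, (j = k ∧ n = 1 ∨ j < k ∧ n = 2 * j + 1) ∧
      (u = 2 * j ∧ v = n ∨ u = n ∧ v = 2 * j) := by
  obtain ⟨j, hj, he⟩ := Finset.mem_image.1 h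
  rw [nextIn_Icc hj] at he
  rw [Finset.mem_Icc] at hj
  refine ⟨j, hj.1, hj.2, _, ?_, (Sym2.eq_iff.1 he).imp
    (fun h => ⟨h.1.symm, h.2.symm⟩) fun h => ⟨h.2.symm, h.1.symm⟩⟩
  split_ifs <;> omega

lemma seg_Icc_mem {k j n : ℕ} (h1 : 1 ≤ j) (hk : j ≤ k)
    (hn : j = k ∧ n = 1 ∨ j < k ∧ n = 2 * j + 1) :
    s(2 * j, n) ∈ segEdges (Finset.Icc 1 k) := by
  have hj := Finset.mem_Icc.2 ⟨h1, hk⟩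
  have := seg_mem hj (nextIn_Icc hj)
  convert this using 2
  split_ifs <;> omega

lemma even_card_of_seg_closed {k : ℕ} {C : Finset ℕ} (hC : C ⊆ pvs (Finset.Icc 1 k))
    (hcl : ∀ u v, s(u, v) ∈ segEdges (Finset.Icc 1 k) → u ∈ C → v ∈ C) : Even C.card := by
  have hCk : ∀ v ∈ C, 1 ≤ v ∧ v ≤ 2 * k := fun v hv => by
    have := Finset.mem_Icc.1 (mem_pvs.1 (hC hv))
    omega
  refine even_card_of_involution
    (fun v => if v % 2 = 0 then (if v = 2 * k then 1 else v + 1)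
      else if v = 1 then 2 * k else v - 1) (fun v hv => ?_) (fun v hv => ?_) fun v hv => ?_
  · have hvk := hCk v hv
    by_cases h2 : v % 2 = 0
    · refine hcl v _ ?_ hv
      obtain ⟨j, rfl⟩ : ∃ j, v = 2 * j := ⟨v / 2, by omega⟩
      refine seg_Icc_mem (by omega) (by omega) ?_
      split_ifs <;> omega
    · refine hcl v _ ?_ hv
      rw [Sym2.eq_swap]
      by_cases h1 : v = 1
      · simpa [h1] using seg_Icc_mem (n := 1) (by omega : 1 ≤ k) le_rfl (by omega)
      · simp only [h2, h1, if_false]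
        obtain ⟨j, rfl⟩ : ∃ j, v = 2 * j + 1 := ⟨v / 2, by omega⟩
        exact seg_Icc_mem (by omega) (by omega) (by omega)
  · have := hCk v hv
    split_ifs <;> omega
  · have := hCk v hv
    generalize hw : (if v % 2 = 0 then (if v = 2 * k then 1 else v + 1)
      else if v = 1 then 2 * k else v - 1) = w
    have hw' : v % 2 = 0 ∧ v = 2 * k ∧ w = 1 ∨ v % 2 = 0 ∧ v ≠ 2 * k ∧ w = v + 1 ∨
        v = 1 ∧ w = 2 * k ∨ v % 2 = 1 ∧ v ≠ 1 ∧ w = v - 1 := by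
      split_ifs at hw <;> omega
    clear hw
    split_ifs <;> omega

/-- A feasible pattern on at least two deleted edges never closes up a single segment. -/
lemma FeasiblePat.segment_notMem {k j : ℕ} {M : Finset (Sym2 ℕ)}
    (hM : IsMatchingOn M (pvs (Finset.Icc 1 k))) (h : FeasiblePat M (Finset.Icc 1 k))
    (h1 : 1 ≤ j) (hk : j < k) : s(2 * j, 2 * j + 1) ∉ M := by
  intro hmem
  have hP : ∀ u v, s(u, v) ∈ M ∪ segEdges (Finset.Icc 1 k) → u = 2 * j ∨ u = 2 * j + 1 →
      v = 2 * j ∨ v = 2 * j + 1 := by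
    intro u v huv hu
    rcases Finset.mem_union.1 huv with huv | huv
    · rcases hu with rfl | rfl
      · exact Or.inr (hM.eq_of_mem huv hmem)
      · exact Or.inl (hM.eq_of_mem huv (Sym2.eq_swap ▸ hmem))
    · obtain ⟨l, -, -, n, hn, h⟩ := seg_Icc_cases huv
      omega
  have := of_reachable hP (h (2 * j) (mem_pvs.2 (Finset.mem_Icc.2 (by omega))) (2 * j - 1)
    (mem_pvs.2 (Finset.mem_Icc.2 (by omega)))) (Or.inl rfl)
  omega

lemma feasiblePat_pair {N : Finset (Sym2 ℕ)} {x y : ℕ} (hxy : x ≠ y)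
    (h1 : s(2 * x - 1, 2 * y - 1) ∈ N) (h2 : s(2 * x, 2 * y) ∈ N) : FeasiblePat N {x, y} := by
  have hnext : nextIn {x, y} x = y := by
    rcases lt_or_gt_of_ne hxy with h | h
    · exact nextIn_eq_of_lt (by simp) h (by simp)
    · exact nextIn_eq_of_wrap (by simp) (by simp; omega) (by simp; omega)
  have h3 : s(2 * x, 2 * y - 1) ∈ segEdges {x, y} := seg_mem (by simp) hnext
  have r1 := reachable_of_mem (Finset.mem_union_left (segEdges {x, y}) h1)
  have r2 := reachable_of_mem (Finset.mem_union_left (segEdges {x, y}) h2)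
  have r3 := reachable_of_mem (Finset.mem_union_right N h3)
  have key : ∀ v ∈ pvs {x, y}, (edgeGraph (N ∪ segEdges {x, y})).Reachable (2 * x) v := by
    intro v hv
    simp only [pvs, Finset.mem_biUnion, Finset.mem_insert, Finset.mem_singleton] at hv
    rcases hv with ⟨j, rfl | rfl, rfl | rfl⟩
    · exact r3.trans r1.symm
    · exact .refl _
    · exact r3
    · exact r2
  exact fun u hu v hv => (key u hu).symm.trans (key v hv)

/-- The two connection patterns of a sequential `2`-swap. -/
lemma SequentialPat.pair_cases {N : Finset (Sym2 ℕ)} {x y : ℕ} (hx : 1 ≤ x) (hy : 1 ≤ y)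
    (hxy : x ≠ y) (hN : IsMatchingOn N (pvs {x, y})) (hs : SequentialPat N {x, y}) :
    (s(2 * x - 1, 2 * y - 1) ∈ N ∧ s(2 * x, 2 * y) ∈ N) ∨
    (s(2 * x - 1, 2 * y) ∈ N ∧ s(2 * x, 2 * y - 1) ∈ N) := by
  have hmem : ∀ v, v ∈ pvs {x, y} ↔ v = 2 * x - 1 ∨ v = 2 * x ∨ v = 2 * y - 1 ∨ v = 2 * y := by
    intro v
    rw [mem_pvs, Finset.mem_insert, Finset.mem_singleton]
    omega
  have hnot : s(2 * x - 1, 2 * x) ∉ N := by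
    intro hmx
    have hP : ∀ u v, s(u, v) ∈ N ∪ ({x, y} : Finset ℕ).image (fun i => s(2 * i - 1, 2 * i)) →
        u = 2 * x - 1 ∨ u = 2 * x → v = 2 * x - 1 ∨ v = 2 * x := by
      intro u v huv hu
      rcases Finset.mem_union.1 huv with huv | huv
      · rcases hu with rfl | rfl
        · exact Or.inr (hN.eq_of_mem huv hmx)
        · exact Or.inl (hN.eq_of_mem huv (Sym2.eq_swap ▸ hmx))
      · obtain ⟨l, hl, he⟩ := Finset.mem_image.1 huv
        rw [Finset.mem_insert, Finset.mem_singleton] at hl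
        rcases Sym2.eq_iff.1 he with ⟨h1, h2⟩ | ⟨h1, h2⟩ <;> omega
    have := of_reachable hP (hs (2 * x) ((hmem _).2 (by omega)) (2 * y)
      ((hmem _).2 (by omega))) (Or.inr rfl)
    omega
  obtain ⟨u, hu, hu', hne⟩ := hN.exists_mem ((hmem (2 * x - 1)).2 (by omega))
  obtain ⟨v, hv, hv', hne'⟩ := hN.exists_mem ((hmem (2 * x)).2 (by omega))
  have huv : u ≠ v := by
    rintro rfl
    have := hN.eq_of_mem (Sym2.eq_swap ▸ hu) (Sym2.eq_swap ▸ hv)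
    omega
  rw [hmem] at hu' hv'
  have hu2 : u ≠ 2 * x := by rintro rfl; exact hnot hu
  have hv2 : v ≠ 2 * x - 1 := by rintro rfl; exact hnot (Sym2.eq_swap ▸ hv)
  rcases hu' with h | h | h | h
  · omega
  · omega
  · left
    rw [← h, show 2 * y = v by omega]
    exact ⟨hu, hv⟩
  · right
    rw [show 2 * y - 1 = v by omega, ← h]
    exact ⟨hu, hv⟩

/-- The fibres of a suitable labelling are the classes of a given equivalence relation. -/
lemma exists_labels {r : Fin 8 → Fin 8 → Prop} (hr : Equivalence r) :
    ∃ f : Fin 8 → Fin 8, (∀ x y, f x = f y ↔ r x y) ∧ (∀ x, f x ≤ x) ∧ ∀ x, r (f x) x := by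
  classical
  have hne : ∀ x, (Finset.univ.filter fun y => r y x).Nonempty := fun x => ⟨x, by simp [hr.refl]⟩
  have hrep : ∀ x, r ((Finset.univ.filter fun y => r y x).min' (hne x)) x := fun x =>
    (Finset.mem_filter.1 (Finset.min'_mem _ (hne x))).2
  refine ⟨fun x => (Finset.univ.filter fun y => r y x).min' (hne x), fun x y => ⟨fun h => ?_,
    fun h => ?_⟩, fun x => Finset.min'_le _ _ (by simp [hr.refl]), hrep⟩
  · have hx := hrep x
    dsimp only at h
    rw [h] at hx
    exact hr.trans (hr.symm hx) (hrep y)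
  · have : (Finset.univ.filter fun z => r z x) = Finset.univ.filter fun z => r z y := by
      ext z
      simpa using ⟨fun hz => hr.trans hz h, fun hz => hr.trans hz (hr.symm h)⟩
    simp only [this]

lemma rel_of_segLabels_eq {r : Fin 8 → Fin 8 → Prop} (hr : Equivalence r) {o : Bool}
    (h12 : r 1 2) (h : if o then r 3 4 ∧ r 5 6 ∧ r 7 0 else r 3 6 ∧ r 7 4 ∧ r 5 0)
    (x y : Fin 8) (hxy : segLabels o x = segLabels o y) : r x y := by
  cases o
  all_goals
    obtain ⟨h1, h2, h3⟩ := h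
    have h12' := hr.symm h12
    have h1' := hr.symm h1
    have h2' := hr.symm h2
    have h3' := hr.symm h3
    fin_cases x <;> fin_cases y <;>
      first | exact hr.refl _ | assumption | (exfalso; revert hxy; decide)

/-- The endpoints of the deleted edges `i`, `i + 1`, `a`, `b`. -/
def terminal (i a b : ℕ) : Fin 8 → ℕ :=
  ![2 * i - 1, 2 * i, 2 * i + 1, 2 * i + 2, 2 * a - 1, 2 * a, 2 * b - 1, 2 * b]

lemma terminal_injective {i a b : ℕ} (hi : 1 ≤ i) (ha : 1 ≤ a) (hb : 1 ≤ b) (hai : a ≠ i)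
    (hai' : a ≠ i + 1) (hbi : b ≠ i) (hbi' : b ≠ i + 1) (hab : a ≠ b) :
    Function.Injective (terminal i a b) := by
  intro x y
  fin_cases x <;> fin_cases y <;> simp [terminal] <;> omega

lemma exists_terminal_eq {i a b v : ℕ} (hi : 1 ≤ i) (ha : 1 ≤ a) (hb : 1 ≤ b) :
    v ∈ pvs ({i, a} ∪ {i + 1, b}) ↔ ∃ x, terminal i a b x = v := by
  simp only [mem_pvs, Finset.mem_union, Finset.mem_insert, Finset.mem_singleton, terminal,
    Fin.exists_fin_succ, Matrix.cons_val_zero, Matrix.cons_val_succ]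
  simp only [IsEmpty.exists_iff, or_false]
  omega

lemma pair_cases_edges {M : Finset (Sym2 ℕ)} {x y : ℕ} {t : Fin 8 → ℕ} {x1 x2 y1 y2 : Fin 8}
    (hx : 1 ≤ x) (hy : 1 ≤ y) (hxy : x ≠ y)
    (hN : IsMatchingOn (subPat M {x, y}) (pvs {x, y})) (hs : SequentialPat (subPat M {x, y}) {x, y})
    (h1 : t x1 = 2 * x - 1) (h2 : t x2 = 2 * x) (h3 : t y1 = 2 * y - 1) (h4 : t y2 = 2 * y) :
    ∃ c, (∀ e ∈ pairEdges x1 x2 y1 y2 c, s(t e.1, t e.2) ∈ subPat M {x, y}) ∧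
      (c = true → FeasiblePat (subPat M {x, y}) {x, y}) := by
  rcases hs.pair_cases hx hy hxy hN with ⟨ha, hb⟩ | ⟨ha, hb⟩
  · refine ⟨true, ?_, fun _ => feasiblePat_pair hxy ha hb⟩
    simpa [pairEdges, h1, h2, h3, h4] using ⟨ha, hb⟩
  · refine ⟨false, ?_, fun h => absurd h (by decide)⟩
    simpa [pairEdges, h1, h2, h3, h4] using ⟨ha, hb⟩

lemma exists_segLabels {i a b : ℕ} (hai : a ≠ i) (hai' : a ≠ i + 1) (hbi : b ≠ i)
    (hbi' : b ≠ i + 1) (hab : a ≠ b) :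
    ∃ o, ∀ x y, segLabels o x = segLabels o y →
      (edgeGraph (segEdges ({i, a} ∪ {i + 1, b}))).Reachable
        (terminal i a b x) (terminal i a b y) := by
  set S : Finset ℕ := {i, a} ∪ {i + 1, b} with hS
  have hmem : ∀ l, l ∈ S ↔ l = i ∨ l = a ∨ l = i + 1 ∨ l = b := by
    intro l
    simp only [hS, Finset.mem_union, Finset.mem_insert, Finset.mem_singleton, or_assoc]
  have hseg : ∀ l m, l ∈ S → m ∈ S →
      ((l < m ∧ ∀ n ∈ S, l < n → m ≤ n) ∨ ((∀ n ∈ S, n ≤ l) ∧ ∀ n ∈ S, m ≤ n)) →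
      (edgeGraph (segEdges S)).Reachable (2 * l) (2 * m - 1) := by
    intro l m hl hm h
    refine reachable_of_mem (seg_mem hl ?_)
    rcases h with ⟨h1, h2⟩ | ⟨h1, h2⟩
    · exact nextIn_eq_of_lt hm h1 h2
    · exact nextIn_eq_of_wrap hm h1 h2
  simp only [hmem, forall_eq_or_imp, forall_eq] at hseg
  have h12 := hseg i (i + 1) (by omega) (by omega) (by omega)
  by_cases ho : (i < a ∧ a < b) ∨ (a < b ∧ b < i) ∨ (b < i ∧ i < a)
  · exact ⟨true, rel_of_segLabels_eq (reachable_equivalence _ _) h12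
      ⟨hseg (i + 1) a (by omega) (by omega) (by omega), hseg a b (by omega) (by omega) (by omega),
        hseg b i (by omega) (by omega) (by omega)⟩⟩
  · exact ⟨false, rel_of_segLabels_eq (reachable_equivalence _ _) h12
      ⟨hseg (i + 1) b (by omega) (by omega) (by omega), hseg b a (by omega) (by omega) (by omega),
        hseg a i (by omega) (by omega) (by omega)⟩⟩

/-- The permutation of the pattern vertices that exchanges the `i`-th and `i+1`-st deleted
edges. -/
def adjPerm (i : ℕ) : Equiv.Perm ℕ :=
  Equiv.swap (2 * i - 1) (2 * i + 1) * Equiv.swap (2 * i) (2 * i + 2)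

lemma swapAdjPat_eq (M : Finset (Sym2 ℕ)) (i : ℕ) :
    swapAdjPat M i = M.image (Sym2.map (adjPerm i)) := rfl

lemma adjPerm_apply {i : ℕ} (hi : 1 ≤ i) (v : ℕ) : adjPerm i v =
    if v = 2 * i - 1 ∨ v = 2 * i then v + 2
    else if v = 2 * i + 1 ∨ v = 2 * i + 2 then v - 2 else v := by
  simp only [adjPerm, Equiv.Perm.mul_apply, Equiv.swap_apply_def]
  split_ifs <;> omega

lemma adjPerm_mem_pvs {i : ℕ} (hi : 1 ≤ i) {S : Finset ℕ} (hS : i ∈ S ↔ i + 1 ∈ S) (v : ℕ) :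
    adjPerm i v ∈ pvs S ↔ v ∈ pvs S := by
  rw [mem_pvs, mem_pvs, adjPerm_apply hi]
  split_ifs with h1 h2
  · rw [show (v + 1) / 2 = i by omega, show (v + 2 + 1) / 2 = i + 1 by omega, hS]
  · rw [show (v + 1) / 2 = i + 1 by omega, show (v - 2 + 1) / 2 = i by omega, hS]
  · rfl

lemma map_mem_swapAdjPat {M : Finset (Sym2 ℕ)} (i : ℕ) {u v : ℕ} (h : s(u, v) ∈ M) :
    s(adjPerm i u, adjPerm i v) ∈ swapAdjPat M i :=
  Finset.mem_image.2 ⟨_, h, rfl⟩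

lemma swap_pairEdges_mem {M : Finset (Sym2 ℕ)} {i a b : ℕ} {c : Bool} {x x' : Fin 8}
    {y y' z z' : Fin 8}
    (h : ∀ e ∈ pairEdges x x' y y' c, s(terminal i a b e.1, terminal i a b e.2) ∈ M)
    (hx : adjPerm i (terminal i a b x) = terminal i a b z)
    (hx' : adjPerm i (terminal i a b x') = terminal i a b z')
    (hy : adjPerm i (terminal i a b y) = terminal i a b y)
    (hy' : adjPerm i (terminal i a b y') = terminal i a b y') :
    ∀ e ∈ pairEdges z z' y y' c, s(terminal i a b e.1, terminal i a b e.2) ∈ swapAdjPat M i := by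
  cases c <;> simp [pairEdges] at h ⊢ <;> rw [← hx, ← hx', ← hy, ← hy'] <;>
    exact ⟨map_mem_swapAdjPat i h.1, map_mem_swapAdjPat i h.2⟩

lemma exists_edge_of_terminal : ∀ (c d : Bool) (x : Fin 8),
    ∃ e ∈ pairEdges 0 1 4 5 c ++ pairEdges 2 3 6 7 d, x = e.1 ∨ x = e.2 := by
  decide

lemma labelsCase_of_labels {f : Fin 8 → Fin 8} (hle : ∀ x, f x ≤ x) (h2 : f 2 = f 1)
    (h1 : ∀ x, f x = f 1 → x = 1 ∨ x = 2) (hidem : ∀ x, f (f x) = f x) : LabelsCase f := by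
  have key : ∀ n y : Fin 8, y ≤ n → y ≠ 1 → y ≠ 2 →
    (n = 0 → y = 0) ∧ (n = 3 → y ∈ [0, 3]) ∧ (n = 4 → y ∈ [0, 3, 4]) ∧ (n = 5 → y ∈ [0, 3, 4, 5]) ∧
    (n = 6 → y ∈ [0, 3, 4, 5, 6]) ∧ (n = 7 → y ∈ [0, 3, 4, 5, 6, 7]) := by decide
  have hne1 : ∀ x, x ≠ 1 → x ≠ 2 → f x ≠ 1 := fun x hx1 hx2 h => by
    have := h1 x (by rw [← hidem x, h])
    tauto
  have hne2 : ∀ x, x ≠ 1 → x ≠ 2 → f x ≠ 2 := fun x hx1 hx2 h => by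
    have := h1 x (by rw [← hidem x, h, h2])
    tauto
  have hk := fun n hn1 hn2 => key n (f n) (hle n) (hne1 n hn1 hn2) (hne2 n hn1 hn2)
  have hf0 : f 0 = 0 := (hk 0 (by decide) (by decide)).1 rfl
  have hf1 : f 1 = 1 := by
    rcases h1 (f 1) (hidem 1) with h | h
    · exact h
    · exact absurd (hle 1) (by rw [h]; decide)
  have hvec : f = ![0, 1, 1, f 3, f 4, f 5, f 6, f 7] := by
    funext x
    fin_cases x <;> simp [hf0, hf1, h2]
  rw [hvec]
  exact labelsCase_vec _ ((hk 3 (by decide) (by decide)).2.1 rfl)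
    _ ((hk 4 (by decide) (by decide)).2.2.1 rfl) _ ((hk 5 (by decide) (by decide)).2.2.2.1 rfl)
    _ ((hk 6 (by decide) (by decide)).2.2.2.2.1 rfl)
    _ ((hk 7 (by decide) (by decide)).2.2.2.2.2 rfl)

/-- The case where `M[Z]` is nonempty and `i`, `i + 1` lie in the two `2`-swaps. -/
lemma feasible_or_reducible_of_pairs {k i a b : ℕ} {M : Finset (Sym2 ℕ)} {Z : Finset ℕ}
    (hM : IsMatchingOn M (pvs (Finset.Icc 1 k))) (hfeas : FeasiblePat M (Finset.Icc 1 k))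
    (hirr : ¬ Reducible M k) (hpart : {i, a} ∪ {i + 1, b} ∪ Z = Finset.Icc 1 k)
    (hXY : Disjoint ({i, a} : Finset ℕ) {i + 1, b}) (hXZ : Disjoint {i, a} Z)
    (hYZ : Disjoint {i + 1, b} Z) (hai : a ≠ i) (hbi : b ≠ i + 1)
    (hMX : IsMatchingOn (subPat M {i, a}) (pvs {i, a}))
    (hsX : SequentialPat (subPat M {i, a}) {i, a})
    (hMY : IsMatchingOn (subPat M {i + 1, b}) (pvs {i + 1, b}))
    (hsY : SequentialPat (subPat M {i + 1, b}) {i + 1, b})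
    (hMZ : IsMatchingOn (subPat M Z) (pvs Z)) (hZ : Z.Nonempty) :
    FeasiblePat (swapAdjPat M i) (Finset.Icc 1 k) ∨ Reducible (swapAdjPat M i) k := by
  classical
  set X : Finset ℕ := {i, a} with hX
  set Y : Finset ℕ := {i + 1, b} with hY
  set K := Finset.Icc 1 k with hK
  have hXK : X ⊆ K := fun l hl => hpart ▸ by simp [hl]
  have hYK : Y ⊆ K := fun l hl => hpart ▸ by simp [hl]
  have hZK : Z ⊆ K := fun l hl => hpart ▸ by simp [hl]
  have hiX : i ∈ X := by simp [hX]
  have haX : a ∈ X := by simp [hX]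
  have hiY : i + 1 ∈ Y := by simp [hY]
  have hbY : b ∈ Y := by simp [hY]
  have hi1 : 1 ≤ i := (Finset.mem_Icc.1 (hXK hiX)).1
  have ha1 : 1 ≤ a := (Finset.mem_Icc.1 (hXK haX)).1
  have hb1 : 1 ≤ b := (Finset.mem_Icc.1 (hYK hbY)).1
  have hai' : a ≠ i + 1 := fun h => Finset.disjoint_left.1 hXY haX (h ▸ hiY)
  have hbi' : b ≠ i := fun h => Finset.disjoint_left.1 hXY hiX (h ▸ hbY)
  have hab : a ≠ b := fun h => Finset.disjoint_left.1 hXY haX (h ▸ hbY)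
  set t := terminal i a b with ht
  have ht0 : t 0 = 2 * i - 1 := rfl
  have ht1 : t 1 = 2 * i := rfl
  have ht2 : t 2 = 2 * i + 1 := rfl
  have ht3 : t 3 = 2 * i + 2 := rfl
  have ht4 : t 4 = 2 * a - 1 := rfl
  have ht5 : t 5 = 2 * a := rfl
  have ht6 : t 6 = 2 * b - 1 := rfl
  have ht7 : t 7 = 2 * b := rfl
  have htinj : Function.Injective t := terminal_injective hi1 ha1 hb1 hai hai' hbi' hbi hab
  have htmem : ∀ v, v ∈ pvs (X ∪ Y) ↔ ∃ x, t x = v := fun v => exists_terminal_eq hi1 ha1 hb1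
  have hXYZ : Disjoint (X ∪ Y) Z := Finset.disjoint_union_left.2 ⟨hXZ, hYZ⟩
  have htZ : ∀ x, t x ∉ pvs Z := fun x hx =>
    Finset.disjoint_left.1 hXYZ (mem_pvs.1 ((htmem _).2 ⟨x, rfl⟩)) (mem_pvs.1 hx)
  have htK : ∀ x, t x ∈ pvs K := fun x => mem_pvs.2
    (Finset.union_subset hXK hYK (mem_pvs.1 ((htmem _).2 ⟨x, rfl⟩)))
  obtain ⟨cX, hcX', hfX⟩ := pair_cases_edges (t := t) hi1 ha1 hai.symm hMX hsX ht0 ht1 ht4 ht5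
  obtain ⟨cY, hcY', hfY⟩ := pair_cases_edges (t := t) (Nat.le_add_left 1 i) hb1 hbi.symm hMY hsY
    (ht2.trans (by omega)) (ht3.trans (by omega)) ht6 ht7
  set EX := pairEdges 0 1 4 5 cX with hEX
  set EY := pairEdges 2 3 6 7 cY with hEY
  have hcX : ∀ e ∈ EX, s(t e.1, t e.2) ∈ M := fun e he => subPat_subset _ _ (hcX' e he)
  have hcY : ∀ e ∈ EY, s(t e.1, t e.2) ∈ M := fun e he => subPat_subset _ _ (hcY' e he)
  have hE : ∀ e ∈ EX ++ EY, s(t e.1, t e.2) ∈ M := fun e he =>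
    (List.mem_append.1 he).elim (hcX e) (hcY e)
  have hMcases : ∀ u v, s(u, v) ∈ M → s(u, v) ∈ subPat M Z ∨
      ∃ e ∈ EX ++ EY, (u = t e.1 ∧ v = t e.2) ∨ (u = t e.2 ∧ v = t e.1) := by
    intro u v huv
    have hu : (u + 1) / 2 ∈ X ∪ Y ∪ Z :=
      hpart ▸ mem_pvs.1 (hM.2.1 _ huv u (Sym2.mem_mk_left _ _))
    rcases Finset.mem_union.1 hu with hu | hu
    · obtain ⟨x, rfl⟩ := (htmem u).1 (mem_pvs.2 hu)
      obtain ⟨e, he, rfl | rfl⟩ := exists_edge_of_terminal cX cY x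
      · exact Or.inr ⟨e, he, Or.inl ⟨rfl, hM.eq_of_mem huv (hE e he)⟩⟩
      · exact Or.inr ⟨e, he, Or.inr ⟨rfl, hM.eq_of_mem huv (Sym2.eq_swap ▸ hE e he)⟩⟩
    · obtain ⟨w, hw, -, -⟩ := hMZ.exists_mem (mem_pvs.2 hu)
      rw [hM.eq_of_mem huv (subPat_subset _ _ hw)]
      exact Or.inl hw
  set K0 := subPat M Z ∪ segEdges K with hK0
  have hr := reachable_equivalence K0 t
  have hterm : ∀ v ∈ pvs K, ∃ x, (edgeGraph K0).Reachable (t x) v := by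
    intro v hv
    refine of_reachable (P := fun v => ∃ x, (edgeGraph K0).Reachable (t x) v) ?_
      (hfeas (t 0) (htK 0) v hv) ⟨0, .refl _⟩
    rintro u w huw ⟨x, hx⟩
    rcases Finset.mem_union.1 huw with huw | huw
    · rcases hMcases u w huw with h | ⟨e, -, ⟨-, rfl⟩ | ⟨-, rfl⟩⟩
      · exact ⟨x, hx.trans (reachable_of_mem (Finset.mem_union_left _ h))⟩
      · exact ⟨_, .refl _⟩
      · exact ⟨_, .refl _⟩
    · exact ⟨x, hx.trans (reachable_of_mem (Finset.mem_union_right _ huw))⟩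
  obtain ⟨f, hf, hfle, hfrep⟩ := exists_labels hr
  have hconnM : LabelsConnected f (EX ++ EY) := by
    set J := (EX ++ EY).foldl mergeLabels f with hJ
    intro y
    have hP : ∃ x, J x = J 0 ∧ (edgeGraph K0).Reachable (t x) (t y) := by
      refine of_reachable (P := fun v => ∃ x, J x = J 0 ∧ (edgeGraph K0).Reachable (t x) v) ?_
        (hfeas (t 0) (htK 0) (t y) (htK y)) ⟨0, rfl, .refl _⟩
      rintro u w huw ⟨x, hJx, hx⟩
      rcases Finset.mem_union.1 huw with huw | huw
      · rcases hMcases u w huw with h | ⟨e, he, ⟨rfl, rfl⟩ | ⟨rfl, rfl⟩⟩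
        · exact ⟨x, hJx, hx.trans (reachable_of_mem (Finset.mem_union_left _ h))⟩
        · refine ⟨e.2, ?_, .refl _⟩
          rw [← hJx, hJ, ← foldl_mergeLabels_edge_eq f he]
          exact apply_foldl_mergeLabels_eq _ ((hf _ _).2 hx.symm)
        · refine ⟨e.1, ?_, .refl _⟩
          rw [← hJx, hJ, foldl_mergeLabels_edge_eq f he]
          exact apply_foldl_mergeLabels_eq _ ((hf _ _).2 hx.symm)
      · exact ⟨x, hJx, hx.trans (reachable_of_mem (Finset.mem_union_right _ huw))⟩
    obtain ⟨x, hJx, hx⟩ := hP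
    exact (apply_foldl_mergeLabels_eq _ ((hf _ _).2 hx.symm)).trans hJx
  have hsound : ∀ (F : Finset (Sym2 ℕ)) (E : List (Fin 8 × Fin 8)), K0 ⊆ F →
      (∀ e ∈ E, s(t e.1, t e.2) ∈ F) → LabelsConnected f E →
      ∀ u ∈ pvs K, ∀ v ∈ pvs K, (edgeGraph F).Reachable u v := by
    intro F E hF hEF hc u hu v hv
    obtain ⟨x, hx⟩ := hterm u hu
    obtain ⟨y, hy⟩ := hterm v hv
    exact (reachable_mono hF hx).symm.trans ((hc.rel (reachable_equivalence F t)
      (fun x y h => reachable_mono hF ((hf x y).1 h)) (fun e he => reachable_of_mem (hEF e he))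
      x y).trans (reachable_mono hF hy))
  have hcontract : ∀ (S : Finset ℕ) (N : Finset (Sym2 ℕ)) (E : List (Fin 8 × Fin 8)),
      Z ⊆ S → S ⊆ K → (∀ u v, s(u, v) ∈ N → u ∈ pvs S ∧ v ∈ pvs S) → subPat M Z ⊆ N →
      (∀ e ∈ E, s(t e.1, t e.2) ∈ N ∨ ∃ j ∈ K \ S, t e.1 = 2 * j - 1 ∧ t e.2 = 2 * j) →
      LabelsConnected f E → FeasiblePat N S := by
    intro S N E hZS hSK hN hZN hEN hc
    have hpv : ∀ u ∈ pvs S, u ∈ pvs K := fun u hu => mem_pvs.2 (hSK (mem_pvs.1 hu))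
    refine feasiblePat_of_contract hSK (hZ.mono hZS) hN fun u hu v hv =>
      hsound _ E ?_ (fun e he => ?_) hc u (hpv u hu) v (hpv v hv)
    · exact (Finset.union_subset_union_left hZN).trans Finset.subset_union_left
    · rcases hEN e he with h | ⟨j, hj, h1, h2⟩
      · exact Finset.mem_union_left _ (Finset.mem_union_left _ h)
      · exact Finset.mem_union_right _ (Finset.mem_image.2 ⟨j, hj, by rw [h1, h2]⟩)
  have hsub : ∀ S u v, s(u, v) ∈ subPat M S → u ∈ pvs S ∧ v ∈ pvs S :=
    fun S u v h => (mem_subPat.1 h).2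
  have hsubmono : ∀ S T, S ⊆ T → subPat M S ⊆ subPat M T := by
    intro S T hST e he
    induction e using Sym2.ind with
    | _ u v =>
    obtain ⟨h, hu, hv⟩ := mem_subPat.1 he
    exact mem_subPat.2 ⟨h, mem_pvs.2 (hST (mem_pvs.1 hu)), mem_pvs.2 (hST (mem_pvs.1 hv))⟩
  have hdX : ∀ S, Disjoint X S → ∀ e ∈ [((0 : Fin 8), (1 : Fin 8)), (4, 5)],
      ∃ j ∈ K \ S, t e.1 = 2 * j - 1 ∧ t e.2 = 2 * j := by
    intro S hS e he
    have h : ∀ j ∈ X, j ∈ K \ S := fun j hj =>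
      Finset.mem_sdiff.2 ⟨hXK hj, Finset.disjoint_left.1 hS hj⟩
    simp only [List.mem_cons, List.not_mem_nil, or_false] at he
    rcases he with rfl | rfl
    · exact ⟨i, h i hiX, ht0, ht1⟩
    · exact ⟨a, h a haX, ht4, ht5⟩
  have hdY : ∀ S, Disjoint Y S → ∀ e ∈ [((2 : Fin 8), (3 : Fin 8)), (6, 7)],
      ∃ j ∈ K \ S, t e.1 = 2 * j - 1 ∧ t e.2 = 2 * j := by
    intro S hS e he
    have h : ∀ j ∈ Y, j ∈ K \ S := fun j hj =>
      Finset.mem_sdiff.2 ⟨hYK hj, Finset.disjoint_left.1 hS hj⟩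
    simp only [List.mem_cons, List.not_mem_nil, or_false] at he
    rcases he with rfl | rfl
    · exact ⟨i + 1, h _ hiY, ht2.trans (by omega), ht3.trans (by omega)⟩
    · exact ⟨b, h b hbY, ht6, ht7⟩
  have hMXY := isMatchingOn_subPat_union hM (Finset.union_subset hXK hYK) hMX hMY
  have hMXZ := isMatchingOn_subPat_union hM (Finset.union_subset hXK hZK) hMX hMZ
  have hMYZ := isMatchingOn_subPat_union hM (Finset.union_subset hYK hZK) hMY hMZ
  have hirrX : ¬ (cX = true ∧ LabelsConnected f (EY ++ [(0, 1), (4, 5)])) := by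
    rintro ⟨hc, hconn⟩
    have hdis : Disjoint X (Y ∪ Z) := Finset.disjoint_union_right.2 ⟨hXY, hXZ⟩
    refine hirr ⟨X, Y ∪ Z, by rw [← Finset.union_assoc, hpart], hdis, ⟨i, hiX⟩,
      ⟨_, Finset.mem_union_left _ hiY⟩, hMX, hMYZ, hfX hc,
      hcontract _ _ _ Finset.subset_union_right (Finset.union_subset hYK hZK) (hsub _)
        (hsubmono _ _ Finset.subset_union_right) (fun e he => ?_) hconn⟩
    exact (List.mem_append.1 he).imp
      (fun h => hsubmono _ _ Finset.subset_union_left (hcY' e h)) (hdX _ hdis e)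
  have hirrY : ¬ (cY = true ∧ LabelsConnected f (EX ++ [(2, 3), (6, 7)])) := by
    rintro ⟨hc, hconn⟩
    have hdis : Disjoint Y (X ∪ Z) := Finset.disjoint_union_right.2 ⟨hXY.symm, hYZ⟩
    refine hirr ⟨Y, X ∪ Z, by rw [← Finset.union_assoc, Finset.union_comm Y X, hpart], hdis,
      ⟨_, hiY⟩, ⟨_, Finset.mem_union_left _ hiX⟩, hMY, hMXZ, hfY hc,
      hcontract _ _ _ Finset.subset_union_right (Finset.union_subset hXK hZK) (hsub _)
        (hsubmono _ _ Finset.subset_union_right) (fun e he => ?_) hconn⟩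
    exact (List.mem_append.1 he).imp
      (fun h => hsubmono _ _ Finset.subset_union_left (hcX' e h)) (hdY _ hdis e)
  have hfZ : LabelsConnected f [(0, 1), (2, 3), (4, 5), (6, 7)] → FeasiblePat (subPat M Z) Z := by
    refine hcontract Z _ _ subset_rfl hZK (hsub _) subset_rfl fun e he => Or.inr ?_
    simp only [List.mem_cons, List.not_mem_nil, or_false] at he
    rcases he with h | h | h | h
    · exact hdX Z hXZ e (by simp [h])
    · exact hdY Z hYZ e (by simp [h])
    · exact hdX Z hXZ e (by simp [h])
    · exact hdY Z hYZ e (by simp [h])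
  obtain ⟨o, ho⟩ := exists_segLabels hai hai' hbi' hbi hab
  have hcyc : ∀ (N : Finset (Sym2 ℕ)) (E : List (Fin 8 × Fin 8)),
      (∀ e ∈ E, s(t e.1, t e.2) ∈ N) → LabelsConnected (segLabels o) E →
      FeasiblePat N (X ∪ Y) := by
    intro N E hEN hc u hu v hv
    obtain ⟨x, rfl⟩ := (htmem u).1 hu
    obtain ⟨y, rfl⟩ := (htmem v).1 hv
    exact hc.rel (reachable_equivalence _ t)
      (fun x y h => reachable_mono Finset.subset_union_right (ho x y h))
      (fun e he => reachable_of_mem (Finset.mem_union_left _ (hEN e he))) x y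
  have hEXY : ∀ e ∈ EX ++ EY, s(t e.1, t e.2) ∈ subPat M (X ∪ Y) := fun e he =>
    (List.mem_append.1 he).elim (fun h => hsubmono _ _ Finset.subset_union_left (hcX' e h))
      fun h => hsubmono _ _ Finset.subset_union_right (hcY' e h)
  have hirrZ : ¬ (LabelsConnected (segLabels o) (EX ++ EY) ∧
      LabelsConnected f [(0, 1), (2, 3), (4, 5), (6, 7)]) := by
    rintro ⟨h1, h2⟩
    exact hirr ⟨X ∪ Y, Z, hpart, hXYZ, ⟨i, by simp [hX]⟩, hZ, hMXY, hMZ,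
      hcyc _ _ hEXY h1, hfZ h2⟩
  have hik : i + 1 ≤ k := (Finset.mem_Icc.1 (hYK hiY)).2
  have hiso : ∀ x, (edgeGraph K0).Reachable (t 1) (t x) → x = 1 ∨ x = 2 := by
    intro x hx
    have hP : ∀ u v, s(u, v) ∈ K0 → u = 2 * i ∨ u = 2 * i + 1 → v = 2 * i ∨ v = 2 * i + 1 := by
      intro u v huv hu
      rcases Finset.mem_union.1 huv with huv | huv
      · have := (mem_subPat.1 huv).2.1
        rcases hu with rfl | rfl
        · exact absurd this (htZ 1)
        · exact absurd this (htZ 2)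
      · obtain ⟨l, hl1, hlk, n, hn, h⟩ := seg_Icc_cases huv
        omega
    rcases of_reachable hP hx (Or.inl rfl) with h | h
    · exact Or.inl (htinj h)
    · exact Or.inr (htinj h)
  have hseg12 : (edgeGraph K0).Reachable (t 1) (t 2) :=
    reachable_of_mem (Finset.mem_union_right _ (seg_Icc_mem hi1 (by omega) (Or.inr ⟨hik, rfl⟩)))
  have heven : ∀ c, Even (Finset.univ.filter fun x => f x = c).card := by
    intro c
    by_cases hc : ∃ x, f x = c
    · obtain ⟨x, rfl⟩ := hc
      set C := (pvs K).filter fun v => (edgeGraph K0).Reachable (t x) v with hC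
      have hCseg : Even C.card := by
        refine even_card_of_seg_closed (k := k) (Finset.filter_subset _ _) fun u v huv hu => ?_
        refine Finset.mem_filter.2 ⟨mem_pvs.2 (Finset.mem_Icc.2 ?_), (Finset.mem_filter.1 hu).2.trans
          (reachable_of_mem (Finset.mem_union_right _ huv))⟩
        obtain ⟨l, hl1, hlk, n, hn, h⟩ := seg_Icc_cases huv
        omega
      have hCZ : Even (C.filter fun v => v ∈ pvs Z).card := by
        refine hMZ.even_card (fun v hv => (Finset.mem_filter.1 hv).2) fun u v huv hu => ?_
        have hv := (mem_subPat.1 huv).2.2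
        exact Finset.mem_filter.2 ⟨Finset.mem_filter.2 ⟨mem_pvs.2 (hZK (mem_pvs.1 hv)),
          (Finset.mem_filter.1 (Finset.mem_filter.1 hu).1).2.trans
            (reachable_of_mem (Finset.mem_union_left _ huv))⟩, hv⟩
      have hCt : (C.filter fun v => v ∉ pvs Z) = (Finset.univ.filter fun y => f y = f x).image t := by
        ext v
        simp only [hC, Finset.mem_filter, Finset.mem_image, Finset.mem_univ, true_and]
        constructor
        · rintro ⟨⟨hv, hxv⟩, hvZ⟩
          have hv' := mem_pvs.1 hv
          rw [← hpart] at hv'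
          rcases Finset.mem_union.1 hv' with h | h
          · obtain ⟨y, rfl⟩ := (htmem v).1 (mem_pvs.2 h)
            exact ⟨y, (hf y x).2 hxv.symm, rfl⟩
          · exact absurd (mem_pvs.2 h) hvZ
        · rintro ⟨y, hy, rfl⟩
          exact ⟨⟨htK y, ((hf y x).1 hy).symm⟩, htZ y⟩
      rw [← Finset.card_image_of_injective _ htinj, ← hCt]
      have := Finset.card_filter_add_card_filter_not (s := C) (fun v => v ∈ pvs Z)
      rw [← this] at hCseg
      exact (Nat.even_add.1 hCseg).1 hCZ
    · rw [Finset.filter_false_of_mem fun x _ hx => hc ⟨x, hx⟩]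
      simp
  have hcase := labelsCase_of_labels hfle ((hf 2 1).2 hseg12.symm)
    (fun x hx => hiso x ((hf 1 x).1 hx.symm)) (fun x => (hf _ _).2 (hfrep x))
    heven o cX cY hconnM hirrX hirrY hirrZ
  have hπ : ∀ x y : Fin 8, t y = (if t x = 2 * i - 1 ∨ t x = 2 * i then t x + 2
    else if t x = 2 * i + 1 ∨ t x = 2 * i + 2 then t x - 2 else t x) → adjPerm i (t x) = t y :=
    fun x y h => (adjPerm_apply hi1 _).trans h.symm
  have hEX' : ∀ e ∈ pairEdges 2 3 4 5 cX, s(t e.1, t e.2) ∈ swapAdjPat M i :=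
    swap_pairEdges_mem hcX (hπ 0 2 (by split_ifs <;> omega)) (hπ 1 3 (by split_ifs <;> omega))
      (hπ 4 4 (by split_ifs <;> omega)) (hπ 5 5 (by split_ifs <;> omega))
  have hEY' : ∀ e ∈ pairEdges 0 1 6 7 cY, s(t e.1, t e.2) ∈ swapAdjPat M i :=
    swap_pairEdges_mem hcY (hπ 2 0 (by split_ifs <;> omega)) (hπ 3 1 (by split_ifs <;> omega))
      (hπ 6 6 (by split_ifs <;> omega)) (hπ 7 7 (by split_ifs <;> omega))
  have hE' : ∀ e ∈ pairEdges 2 3 4 5 cX ++ pairEdges 0 1 6 7 cY,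
      s(t e.1, t e.2) ∈ swapAdjPat M i := fun e he => (List.mem_append.1 he).elim (hEX' e) (hEY' e)
  have hZsub : subPat M Z ⊆ subPat (swapAdjPat M i) Z := by
    intro e he
    induction e using Sym2.ind with
    | _ u v =>
    obtain ⟨huv, hu, hv⟩ := mem_subPat.1 he
    have hfix : ∀ w ∈ pvs Z, adjPerm i w = w := by
      intro w hw
      have h0 : w ≠ t 0 := fun h => htZ 0 (h ▸ hw)
      have h1 : w ≠ t 1 := fun h => htZ 1 (h ▸ hw)
      have h2 : w ≠ t 2 := fun h => htZ 2 (h ▸ hw)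
      have h3 : w ≠ t 3 := fun h => htZ 3 (h ▸ hw)
      rw [adjPerm_apply hi1]
      split_ifs <;> omega
    have := map_mem_swapAdjPat i huv
    rw [hfix u hu, hfix v hv] at this
    exact mem_subPat.2 ⟨this, hu, hv⟩
  have hπXY := adjPerm_mem_pvs hi1 (S := X ∪ Y) (by simp [hiX, hiY])
  have hπZ := adjPerm_mem_pvs hi1 (S := Z) (iff_of_false (Finset.disjoint_left.1 hXZ hiX)
    (Finset.disjoint_left.1 hYZ hiY))
  rcases hcase with h | ⟨h1, h2⟩
  · exact Or.inl (hsound _ _ (Finset.union_subset_union_left (hZsub.trans (subPat_subset _ _)))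
      (fun e he => Finset.mem_union_left _ (hE' e he)) h)
  · refine Or.inr ⟨X ∪ Y, Z, hpart, hXYZ, ⟨i, by simp [hX]⟩, hZ, ?_, ?_,
      hcyc _ _ (fun e he => ?_) h1, (hfZ h2).mono hZsub⟩
    · rw [swapAdjPat_eq, subPat_image _ hπXY]
      exact hMXY.image _ hπXY
    · rw [swapAdjPat_eq, subPat_image _ hπZ]
      exact hMZ.image _ hπZ
    · exact mem_subPat.2 ⟨hE' e he, (htmem _).2 ⟨_, rfl⟩, (htmem _).2 ⟨_, rfl⟩⟩

lemma reducible_of_halves {M : Finset (Sym2 ℕ)}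
    (hM : IsMatchingOn M (pvs (Finset.Icc 1 4))) (hfeas : FeasiblePat M (Finset.Icc 1 4))
    (hMX : IsMatchingOn (subPat M {2, 1}) (pvs {2, 1}))
    (hsX : SequentialPat (subPat M {2, 1}) {2, 1})
    (hMY : IsMatchingOn (subPat M {3, 4}) (pvs {3, 4}))
    (hsY : SequentialPat (subPat M {3, 4}) {3, 4}) : Reducible M 4 := by
  refine ⟨{2, 1}, {3, 4}, by decide, by decide, by simp, by simp, hMX, hMY, ?_, ?_⟩
  · rcases hsX.pair_cases (by decide) (by decide) (by decide) hMX with ⟨h1, h2⟩ | ⟨h1, -⟩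
    · exact feasiblePat_pair (by decide) h1 h2
    · exact absurd (Sym2.eq_swap ▸ subPat_subset _ _ h1)
        (hfeas.segment_notMem hM (j := 1) (by decide) (by decide))
  · rcases hsY.pair_cases (by decide) (by decide) (by decide) hMY with ⟨h1, h2⟩ | ⟨-, h2⟩
    · exact feasiblePat_pair (by decide) h1 h2
    · exact absurd (subPat_subset _ _ h2)
        (hfeas.segment_notMem hM (j := 3) (by decide) (by decide))

lemma Finset.exists_eq_pair_of_mem {S : Finset ℕ} {i : ℕ} (hS : S.card = 2) (hi : i ∈ S) :
    ∃ a, a ≠ i ∧ S = {i, a} := by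
  obtain ⟨x, y, hxy, rfl⟩ := Finset.card_eq_two.1 hS
  rcases Finset.mem_insert.1 hi with rfl | hi
  · exact ⟨y, hxy.symm, rfl⟩
  · rw [Finset.mem_singleton] at hi
    subst hi
    exact ⟨x, hxy, Finset.pair_comm _ _⟩

lemma feasible_or_reducible_of_mem {k i : ℕ} {M : Finset (Sym2 ℕ)} {X Y Z : Finset ℕ}
    (hM : IsMatchingOn M (pvs (Finset.Icc 1 k))) (hfeas : FeasiblePat M (Finset.Icc 1 k))
    (hirr : ¬ Reducible M k) (hpart : X ∪ Y ∪ Z = Finset.Icc 1 k)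
    (hXY : Disjoint X Y) (hXZ : Disjoint X Z) (hYZ : Disjoint Y Z)
    (hX2 : X.card = 2) (hY2 : Y.card = 2)
    (hMX : IsMatchingOn (subPat M X) (pvs X)) (hsX : SequentialPat (subPat M X) X)
    (hMY : IsMatchingOn (subPat M Y) (pvs Y)) (hsY : SequentialPat (subPat M Y) Y)
    (hMZ : IsMatchingOn (subPat M Z) (pvs Z))
    (hone : ∀ j ∈ Finset.Icc 1 (k - 1), (j ∈ X ∧ j + 1 ∈ Y) ∨ (j ∈ Y ∧ j + 1 ∈ X) → j = i)
    (hiX : i ∈ X) (hiY : i + 1 ∈ Y) :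
    FeasiblePat (swapAdjPat M i) (Finset.Icc 1 k) ∨ Reducible (swapAdjPat M i) k := by
  obtain ⟨a, hai, rfl⟩ := Finset.exists_eq_pair_of_mem hX2 hiX
  obtain ⟨b, hbi, rfl⟩ := Finset.exists_eq_pair_of_mem hY2 hiY
  rcases Z.eq_empty_or_nonempty with rfl | hZ
  · refine absurd ?_ hirr
    rw [Finset.union_empty] at hpart
    have hk : k = 4 := by
      have h := Finset.card_union_of_disjoint hXY
      rw [hpart, hX2, hY2, Nat.card_Icc] at h
      omega
    subst hk
    have hsub : ∀ l, l ∈ ({i, a} ∪ {i + 1, b} : Finset ℕ) ↔ l ∈ Finset.Icc 1 4 := by simp [hpart]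
    simp only [Finset.mem_union, Finset.mem_insert, Finset.mem_singleton, Finset.mem_Icc] at hsub hone
    have hi := (hsub i).1 (by simp)
    have hi' := (hsub (i + 1)).1 (by simp)
    have ha := (hsub a).1 (by simp)
    have hb := (hsub b).1 (by simp)
    have h1 := (hsub 1).2 (by decide)
    have h2 := (hsub 2).2 (by decide)
    have h3 := (hsub 3).2 (by decide)
    have h4 := (hsub 4).2 (by decide)
    have o1 := hone 1 (by decide)
    have o2 := hone 2 (by decide)
    have o3 := hone 3 (by decide)
    obtain ⟨rfl, rfl, rfl⟩ : i = 2 ∧ a = 1 ∧ b = 4 := by omega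
    exact reducible_of_halves hM hfeas hMX hsX hMY hsY
  · exact feasible_or_reducible_of_pairs hM hfeas hirr hpart hXY hXZ hYZ hai hbi hMX hsX hMY hsY
      hMZ hZ

/-- Let `M` be a feasible irreducible connection `k`-pattern that decomposes into three
sequential swaps `M[X]`, `M[Y]`, `M[Z]` with `|X| = |Y| = 2`.  If there is exactly one
index `i ∈ [k−1]` with (`i ∈ X` and `i+1 ∈ Y`) or (`i ∈ Y` and `i+1 ∈ X`), then the
connection pattern obtained from `M` by swapping `i` and `i+1` is either feasible or
reducible. -/
theorem swap_adjacent_feasible_or_reducible (k : ℕ) (M : Finset (Sym2 ℕ))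
    (X Y Z : Finset ℕ) (i : ℕ)
    (hM : IsMatchingOn M (pvs (Finset.Icc 1 k)))
    (hfeas : FeasiblePat M (Finset.Icc 1 k))
    (hirr : ¬ Reducible M k)
    (hpart : X ∪ Y ∪ Z = Finset.Icc 1 k)
    (hXY : Disjoint X Y) (hXZ : Disjoint X Z) (hYZ : Disjoint Y Z)
    (hX2 : X.card = 2) (hY2 : Y.card = 2)
    (hMX : IsMatchingOn (subPat M X) (pvs X)) (hsX : SequentialPat (subPat M X) X)
    (hMY : IsMatchingOn (subPat M Y) (pvs Y)) (hsY : SequentialPat (subPat M Y) Y)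
    (hMZ : IsMatchingOn (subPat M Z) (pvs Z)) (hsZ : SequentialPat (subPat M Z) Z)
    (hone : ((Finset.Icc 1 (k - 1)).filter fun j =>
        (j ∈ X ∧ j + 1 ∈ Y) ∨ (j ∈ Y ∧ j + 1 ∈ X)) = {i}) :
    FeasiblePat (swapAdjPat M i) (Finset.Icc 1 k) ∨ Reducible (swapAdjPat M i) k := by
  have hi := Finset.mem_singleton_self i
  rw [← hone, Finset.mem_filter] at hi
  have huniq : ∀ j ∈ Finset.Icc 1 (k - 1),
      (j ∈ X ∧ j + 1 ∈ Y) ∨ (j ∈ Y ∧ j + 1 ∈ X) → j = i := fun j hj h =>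
    Finset.mem_singleton.1 (hone ▸ Finset.mem_filter.2 ⟨hj, h⟩)
  rcases hi.2 with ⟨hiX, hiY⟩ | ⟨hiY, hiX⟩
  · exact feasible_or_reducible_of_mem hM hfeas hirr hpart hXY hXZ hYZ hX2 hY2 hMX hsX hMY hsY hMZ
      huniq hiX hiY
  · exact feasible_or_reducible_of_mem hM hfeas hirr (by rwa [Finset.union_comm Y X]) hXY.symm hYZ
      hXZ hY2 hX2 hMY hsY hMX hsX hMZ (fun j hj h => huniq j hj h.symm) hiY hiX
end

section
/- For any partition of [k] = {1,…,k} into nonempty parts X_1,…,X_c, the multigraph obtained from the cycle on vertex set [k] (with edges {i, i+1} for i ∈ [k−1] and the edge {k, 1}) by identifying, for each part X_j, all vertices of X_j into a single vertex, is an even multigraph with exactly k edges; consequently, for every ε > 0 and all sufficiently large k its pathwidth is at most (23/135 + ε)·k. -/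
/-- The multiset of endpoints of an unordered pair (a loop contributes its vertex twice). -/
def Sym2.toMul {V : Type} : Sym2 V → Multiset V :=
  Sym2.lift ⟨fun a b => {a, b}, fun a b => Multiset.pair_comm a b⟩

/-- The degree of a vertex in a multigraph given by an endpoint map (loops count twice). -/
def Multigraph.deg {V E : Type} [Fintype E] [DecidableEq V]
    (ends : E → Sym2 V) (v : V) : ℕ :=
  ∑ e : E, Multiset.count v (ends e).toMul

/-- `X` is a path decomposition of the multigraph with endpoint map `ends`. -/
def Multigraph.IsPathDecomp {V E : Type} (ends : E → Sym2 V) (r : ℕ)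
    (X : Fin (r + 1) → Finset V) : Prop :=
  (∀ v : V, ∃ t, v ∈ X t) ∧
  (∀ (v : V) (a b c : Fin (r + 1)), a ≤ b → b ≤ c → v ∈ X a → v ∈ X c → v ∈ X b) ∧
  (∀ e : E, ∃ t, ∀ u, u ∈ ends e → u ∈ X t)

/-- The pathwidth of a multigraph. -/
noncomputable def Multigraph.pathwidth {V E : Type} (ends : E → Sym2 V) : ℕ :=
  sInf {w : ℕ | ∃ (r : ℕ) (X : Fin (r + 1) → Finset V),
    Multigraph.IsPathDecomp ends r X ∧ ∀ t, (X t).card ≤ w + 1}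

/-- The multigraph obtained from the cycle on vertex set `[k]` (edges `{i, i+1}` cyclically)
by identifying the vertices within each part of a partition, the partition being given by
the identification map `g` onto the set of parts (`g` is surjective iff all parts are
nonempty).  Its vertices are the parts, and its `k` edges are indexed by the edges of the
cycle: the edge `{j, j+1}` becomes `{g j, g (j+1)}` (a loop if `g j = g (j+1)`). -/
def cycleQuotEnds (k c : ℕ) (g : Fin k → Fin c) : Fin k → Sym2 (Fin c) :=
  fun j => s(g j, g (finRotate k j))

/-- The limiting probability that `j` independent uniform points of an interval lie on both sides
of its midpoint, rounded up to `1` for `j ≥ 6`. -/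
noncomputable def spanCost (j : ℕ) : ℝ :=
  if j = 0 then 0 else if j ≤ 5 then 1 - 2 / 2 ^ j else 1

lemma spanCost_zero : spanCost 0 = 0 := by simp [spanCost]

lemma spanCost_one : spanCost 1 = 0 := by norm_num [spanCost]

lemma spanCost_le_one (j : ℕ) : spanCost j ≤ 1 := by
  unfold spanCost
  split_ifs
  · norm_num
  · have : (0 : ℝ) ≤ 2 / 2 ^ j := by positivity
    linarith
  · exact le_rfl

lemma spanCost_mono : Monotone spanCost := by
  refine monotone_nat_of_le_succ fun j => ?_
  rcases Nat.lt_or_ge j 5 with h | h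
  · interval_cases j <;> norm_num [spanCost]
  · have : spanCost (j + 1) = 1 := by
      unfold spanCost
      rw [if_neg (by omega), if_neg (by omega)]
    rw [this]
    exact spanCost_le_one j

/-- The amount charged to a vertex of degree `d`; it satisfies
`(d + 1) * potential d = d * potential (d - 1) + spanCost d` for `d ≥ 3`. -/
noncomputable def potential (d : ℕ) : ℝ :=
  if d ≤ 2 then 0 else if d = 3 then 3 / 16 else if d = 4 then 13 / 40
  else 1 - 55 / (16 * (d + 1))

lemma potential_of_five_le {d : ℕ} (h : 5 ≤ d) : potential d = 1 - 55 / (16 * ((d : ℝ) + 1)) := by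
  unfold potential
  rw [if_neg (by omega), if_neg (by omega), if_neg (by omega)]

lemma potential_mono : Monotone potential := by
  refine monotone_nat_of_le_succ fun d => ?_
  rcases Nat.lt_or_ge d 5 with h | h
  · interval_cases d <;> norm_num [potential]
  · rw [potential_of_five_le h, potential_of_five_le (by omega)]
    push_cast
    gcongr
    linarith

lemma potential_zero : potential 0 = 0 := by simp [potential]

lemma potential_nonneg (d : ℕ) : 0 ≤ potential d :=
  potential_zero ▸ potential_mono (Nat.zero_le d)

lemma potential_succ_sub_antitone {d : ℕ} (h : 2 ≤ d) :
    potential (d + 2) - potential (d + 1) ≤ potential (d + 1) - potential d := by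
  rcases Nat.lt_or_ge d 5 with h' | h'
  · interval_cases d <;> norm_num [potential]
  · rw [potential_of_five_le h', potential_of_five_le (by omega), potential_of_five_le (by omega)]
    have hd : (5 : ℝ) ≤ d := by exact_mod_cast h'
    have h0 : (0 : ℝ) < d + 1 := by linarith
    have h1 : (0 : ℝ) < d + 2 := by linarith
    have h2 : (0 : ℝ) < d + 3 := by linarith
    have e1 : 55 / (16 * ((d : ℝ) + 1)) - 55 / (16 * ((d : ℝ) + 2)) =
        55 / (16 * (((d : ℝ) + 1) * (d + 2))) := by field_simp; ring
    have e2 : 55 / (16 * ((d : ℝ) + 2)) - 55 / (16 * ((d : ℝ) + 3)) =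
        55 / (16 * (((d : ℝ) + 2) * (d + 3))) := by field_simp; ring
    have e3 : 55 / (16 * (((d : ℝ) + 2) * (d + 3))) ≤ 55 / (16 * (((d : ℝ) + 1) * (d + 2))) := by
      gcongr 55 / (16 * ?_)
      nlinarith
    push_cast
    rw [show (d : ℝ) + 2 + 1 = d + 3 by ring, show (d : ℝ) + 1 + 1 = d + 2 by ring]
    linarith

lemma spanCost_le_potential {r : ℕ} (h : 2 ≤ r) :
    spanCost (r + 1) ≤ potential (r + 1) + (r + 1) * (potential (r + 1) - potential r) := by
  rcases Nat.lt_or_ge r 5 with h' | h'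
  · interval_cases r <;> norm_num [potential, spanCost]
  · rw [potential_of_five_le h', potential_of_five_le (by omega)]
    refine (spanCost_le_one _).trans ?_
    push_cast
    have h0 : (0 : ℝ) < r + 1 := by positivity
    have h1 : (0 : ℝ) < r + 2 := by positivity
    rw [show (r : ℝ) + 1 + 1 = r + 2 by ring]
    apply le_of_eq
    field_simp
    ring

lemma spanCost_le_potential_of_le {r j : ℕ} (hj : 3 ≤ j) (hr : j ≤ r) :
    spanCost r ≤ potential r + r * (potential j - potential (j - 1)) := by
  obtain ⟨i, rfl⟩ : ∃ i, j = i + 1 := ⟨j - 1, by omega⟩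
  obtain ⟨n, rfl⟩ : ∃ n, r = i + n + 1 := ⟨r - i - 1, by omega⟩
  have key : potential (i + n + 1) - potential (i + n) ≤ potential (i + 1) - potential i := by
    clear hr
    induction n with
    | zero => simp
    | succ n ih =>
      exact (potential_succ_sub_antitone (show 2 ≤ i + n by omega)).trans ih
  refine (spanCost_le_potential (show 2 ≤ i + n by omega)).trans ?_
  push_cast
  gcongr

lemma potential_le_of_even {d : ℕ} (h : Even d) : potential d ≤ 23 / 270 * d := by
  obtain ⟨n, rfl⟩ := h
  rcases Nat.lt_or_ge n 6 with h' | h'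
  · interval_cases n <;> norm_num [potential]
  · rw [potential_of_five_le (by omega)]
    have hn : (6 : ℝ) ≤ n := by exact_mod_cast h'
    have : (0 : ℝ) ≤ 55 / (16 * (((n + n : ℕ) : ℝ) + 1)) := by positivity
    push_cast at *
    linarith

section Clustering

variable {V E : Type} [DecidableEq V]

/-- Number of blobs with two boundary vertices, one of which is `x`. -/
def pairDegree (B : Finset E) (bd : E → Finset V) (x : V) : ℕ :=
  (B.filter fun b => x ∈ bd b ∧ (bd b).card = 2).card

/-- Total weight of the blobs with nonempty boundary. -/
def activeWeight (B : Finset E) (bd : E → Finset V) (wt : E → ℕ) : ℕ :=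
  ∑ b ∈ B, if (bd b).Nonempty then wt b else 0

lemma pairDegree_sdiff_le (B : Finset E) {bd : E → Finset V} (hbd : ∀ b ∈ B, (bd b).card ≤ 2)
    (D : Finset V) (x : V) : pairDegree B (fun b => bd b \ D) x ≤ pairDegree B bd x := by
  refine Finset.card_le_card fun b hb => ?_
  simp only [Finset.mem_filter, Finset.mem_sdiff] at hb ⊢
  refine ⟨hb.1, hb.2.1.1, le_antisymm (hbd b hb.1) ?_⟩
  rw [← hb.2.2]
  exact Finset.card_le_card Finset.sdiff_subset

lemma pairDegree_sdiff_eq_zero (B : Finset E) (bd : E → Finset V) {D : Finset V} {x : V}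
    (hx : x ∈ D) : pairDegree B (fun b => bd b \ D) x = 0 := by
  simp [pairDegree, hx]

lemma activeWeight_sdiff_le (B : Finset E) (bd : E → Finset V) (wt : E → ℕ) (D : Finset V) :
    activeWeight B (fun b => bd b \ D) wt ≤ activeWeight B bd wt := by
  refine Finset.sum_le_sum fun b _ => ?_
  split_ifs with h1 h2
  · exact le_rfl
  · exact absurd (h1.mono Finset.sdiff_subset) h2
  · exact Nat.zero_le _
  · exact le_rfl

lemma pairDegree_eq_add_erase [DecidableEq E] {B : Finset E} (bd : E → Finset V) {b : E}
    (hb : b ∈ B) {x : V} : pairDegree B bd x =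
      (if x ∈ bd b ∧ (bd b).card = 2 then 1 else 0) + pairDegree (B.erase b) bd x := by
  unfold pairDegree
  rw [Finset.card_filter, Finset.card_filter, Finset.add_sum_erase B
    (fun e => if x ∈ bd e ∧ (bd e).card = 2 then 1 else 0) hb]

variable [Fintype V] [DecidableEq E]

/-- The clusters, under the labelling `a`, of the blobs having `x` on their boundary. -/
def clustersAt (B : Finset E) (bd : E → Finset V) (a : E → E) (x : V) : Finset E :=
  (B.filter fun b => x ∈ bd b).image a

/-- The blobs can be grouped into clusters of weight at most `2 * L` such that the total
`spanCost` of the vertices is bounded by their total `potential`, up to an error term. -/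
def HasClustering (L : ℕ) (B : Finset E) (bd : E → Finset V) (wt : E → ℕ) : Prop :=
  ∃ a : E → E, (∀ c, (∑ b ∈ B, if a b = c then wt b else 0) ≤ 2 * L) ∧
    ∑ x, spanCost (clustersAt B bd a x).card ≤
      ∑ x, potential (pairDegree B bd x) + 2 / L * activeWeight B bd wt

lemma hasClustering_of_forall_eq_empty {L : ℕ} {B : Finset E} {bd : E → Finset V} {wt : E → ℕ}
    (hwt : ∀ b ∈ B, wt b ≤ 2 * L) (h : ∀ b ∈ B, bd b = ∅) : HasClustering L B bd wt := by
  refine ⟨id, fun c => ?_, ?_⟩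
  · simp only [id, Finset.sum_ite_eq']
    split_ifs with hc
    · exact hwt c hc
    · exact Nat.zero_le _
  · have : ∀ x, clustersAt B bd id x = ∅ := fun x => by
      simp only [clustersAt, Finset.image_id, Finset.filter_eq_empty_iff]
      intro b hb
      simp [h b hb]
    simp only [this, Finset.card_empty, spanCost_zero, Finset.sum_const_zero]
    have := Finset.sum_nonneg fun x (_ : x ∈ Finset.univ) => potential_nonneg (pairDegree B bd x)
    positivity

lemma HasClustering.of_sdiff {L : ℕ} {B : Finset E} {bd : E → Finset V} {wt : E → ℕ}
    (D : Finset V) (h : HasClustering L B (fun b => bd b \ D) wt)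
    (hD : ∑ x ∈ D, spanCost (B.filter fun b => x ∈ bd b).card +
        ∑ x, potential (pairDegree B (fun b => bd b \ D) x) +
        2 / L * activeWeight B (fun b => bd b \ D) wt ≤
      ∑ x, potential (pairDegree B bd x) + 2 / L * activeWeight B bd wt) :
    HasClustering L B bd wt := by
  obtain ⟨a, ha, hc⟩ := h
  refine ⟨a, ha, le_trans ?_ hD⟩
  rw [add_assoc]
  refine le_trans ?_ (add_le_add_right hc _)
  rw [← Finset.sum_sdiff (Finset.subset_univ D), add_comm]
  gcongr ?_ + ?_
  · refine Finset.sum_le_sum fun x _ => spanCost_mono Finset.card_image_le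
  · rw [← Finset.sum_sdiff (Finset.subset_univ D) (f := fun x =>
      spanCost (clustersAt B (fun b => bd b \ D) a x).card)]
    have h1 : ∑ x ∈ D, spanCost (clustersAt B (fun b => bd b \ D) a x).card = 0 := by
      refine Finset.sum_eq_zero fun x hx => ?_
      simp [clustersAt, hx, spanCost_zero]
    rw [h1, add_zero]
    refine le_of_eq (Finset.sum_congr rfl fun x hx => ?_)
    have hx' : x ∉ D := (Finset.mem_sdiff.mp hx).2
    simp [clustersAt, hx']

lemma HasClustering.of_heavy {L : ℕ} (hL : 0 < L) {B : Finset E} {bd : E → Finset V} {wt : E → ℕ}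
    (hbd : ∀ b ∈ B, (bd b).card ≤ 2) {b : E} (hb : b ∈ B) (hne : (bd b).Nonempty) (hw : L < wt b)
    (h : HasClustering L B (fun b' => bd b' \ bd b) wt) : HasClustering L B bd wt := by
  refine h.of_sdiff (bd b) ?_
  have h1 : ∑ x ∈ bd b, spanCost (B.filter fun b => x ∈ bd b).card ≤ 2 := by
    calc _ ≤ ∑ x ∈ bd b, (1 : ℝ) := Finset.sum_le_sum fun x _ => spanCost_le_one _
      _ = (bd b).card := by simp
      _ ≤ 2 := by exact_mod_cast hbd b hb
  have h2 : ∑ x, potential (pairDegree B (fun b' => bd b' \ bd b) x) ≤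
      ∑ x, potential (pairDegree B bd x) :=
    Finset.sum_le_sum fun x _ => potential_mono (pairDegree_sdiff_le B hbd _ x)
  have h3 : activeWeight B (fun b' => bd b' \ bd b) wt + L ≤ activeWeight B bd wt := by
    unfold activeWeight
    rw [← Finset.add_sum_erase _ _ hb, ← Finset.add_sum_erase B _ hb]
    have := activeWeight_sdiff_le (B.erase b) bd wt (bd b)
    unfold activeWeight at this
    simp only [sdiff_self, Finset.bot_eq_empty, Finset.not_nonempty_empty, if_false,
      if_pos hne] at this ⊢
    omega
  have h4 : (activeWeight B (fun b' => bd b' \ bd b) wt : ℝ) + L ≤ activeWeight B bd wt := by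
    exact_mod_cast h3
  have hL' : (0 : ℝ) < L := by exact_mod_cast hL
  have h5 : (2 : ℝ) / L * (activeWeight B (fun b' => bd b' \ bd b) wt + L) ≤
      2 / L * activeWeight B bd wt := by gcongr
  have h6 : (2 : ℝ) / L * L = 2 := by field_simp
  rw [mul_add, h6] at h5
  linarith

lemma HasClustering.of_merge {L : ℕ} {B : Finset E} {bd : E → Finset V} {wt : E → ℕ}
    {b b' : E} (hb : b ∈ B) (hb' : b' ∈ B) (hne : b ≠ b') (D : Finset V)
    (hD : ∀ x ∈ D, ∀ e ∈ B, x ∈ bd e → e = b ∨ e = b')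
    (hbn : (bd b).Nonempty) (hbn' : (bd b').Nonempty)
    (hdeg : ∀ x, pairDegree (B.erase b') (Function.update bd b ((bd b ∪ bd b') \ D)) x ≤
      pairDegree B bd x)
    (h : HasClustering L (B.erase b') (Function.update bd b ((bd b ∪ bd b') \ D))
      (Function.update wt b (wt b + wt b'))) : HasClustering L B bd wt := by
  obtain ⟨a, ha, hc⟩ := h
  have hb2 : b ∈ B.erase b' := Finset.mem_erase.mpr ⟨hne, hb⟩
  refine ⟨Function.update a b' (a b), fun c => ?_, ?_⟩
  · refine le_trans (le_of_eq ?_) (ha c)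
    rw [← Finset.add_sum_erase _ _ hb', ← Finset.add_sum_erase _ _ hb2,
      ← Finset.add_sum_erase _ _ hb2, ← add_assoc]
    congr 1
    · simp only [Function.update_self, Function.update_of_ne hne]
      split_ifs <;> omega
    · refine Finset.sum_congr rfl fun e he => ?_
      simp only [Finset.mem_erase] at he
      rw [Function.update_of_ne he.2.1, Function.update_of_ne he.1]
  · refine le_trans (Finset.sum_le_sum fun x _ => ?_) (hc.trans ?_)
    · by_cases hx : x ∈ D
      · have : clustersAt B bd (Function.update a b' (a b)) x ⊆ {a b} := by
          intro c hc
          simp only [clustersAt, Finset.mem_image, Finset.mem_filter] at hc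
          obtain ⟨e, ⟨he, hxe⟩, rfl⟩ := hc
          rcases hD x hx e he hxe with rfl | rfl
          · simp [Function.update_of_ne hne]
          · simp
        refine (spanCost_mono (Finset.card_le_card this)).trans ?_
        rw [Finset.card_singleton, spanCost_one, ← spanCost_zero]
        exact spanCost_mono (Nat.zero_le _)
      · refine spanCost_mono (Finset.card_le_card fun c hc => ?_)
        simp only [clustersAt, Finset.mem_image, Finset.mem_filter, Finset.mem_erase] at hc ⊢
        obtain ⟨e, ⟨he, hxe⟩, rfl⟩ := hc
        by_cases h1 : e = b'
        · subst h1
          exact ⟨b, ⟨⟨hne, hb⟩, by simp [hx, hxe]⟩, by simp⟩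
        · refine ⟨e, ⟨⟨h1, he⟩, ?_⟩, by simp [Function.update_of_ne h1]⟩
          by_cases h2 : e = b
          · subst h2
            simp [hx, hxe]
          · rwa [Function.update_of_ne h2]
    · have hw : activeWeight (B.erase b') (Function.update bd b ((bd b ∪ bd b') \ D))
          (Function.update wt b (wt b + wt b')) ≤ activeWeight B bd wt := by
        unfold activeWeight
        rw [← Finset.add_sum_erase B _ hb', ← Finset.add_sum_erase _ _ hb2,
          ← Finset.add_sum_erase (B.erase b') _ hb2, ← add_assoc, if_pos hbn, if_pos hbn']
        refine add_le_add ?_ (le_of_eq (Finset.sum_congr rfl fun e he => ?_))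
        · rw [Function.update_self, Function.update_self]
          split_ifs <;> omega
        · have := (Finset.mem_erase.mp he).1
          rw [Function.update_of_ne this, Function.update_of_ne this]
      gcongr with x
      exact potential_mono (hdeg x)

lemma HasClustering.of_nested {L : ℕ} {B : Finset E} {bd : E → Finset V} {wt : E → ℕ}
    {b b' : E} (hb : b ∈ B) (hb' : b' ∈ B) (hne : b ≠ b') (hbn' : (bd b').Nonempty)
    (hsub : bd b' ⊆ bd b)
    (h : HasClustering L (B.erase b') (Function.update bd b ((bd b ∪ bd b') \ ∅))
      (Function.update wt b (wt b + wt b'))) : HasClustering L B bd wt := by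
  refine h.of_merge hb hb' hne ∅ (by simp) (hbn'.mono hsub) hbn' fun x => ?_
  rw [Finset.sdiff_empty, Finset.union_eq_left.mpr hsub, Function.update_eq_self]
  exact Finset.card_le_card (Finset.filter_subset_filter _ (Finset.erase_subset _ _))

lemma HasClustering.of_card_eq_two {L : ℕ} {B : Finset E} {bd : E → Finset V} {wt : E → ℕ}
    {b b' : E} {x : V} (hne : b ≠ b') (hx : (B.filter fun e => x ∈ bd e) = {b, b'})
    (hcard : (bd b).card ≤ 2) (hcard' : (bd b').card = 2)
    (h : HasClustering L (B.erase b') (Function.update bd b ((bd b ∪ bd b') \ {x}))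
      (Function.update wt b (wt b + wt b'))) : HasClustering L B bd wt := by
  have hb : b ∈ B ∧ x ∈ bd b := by
    have : b ∈ B.filter fun e => x ∈ bd e := by simp [hx]
    simpa using this
  have hb' : b' ∈ B ∧ x ∈ bd b' := by
    have : b' ∈ B.filter fun e => x ∈ bd e := by simp [hx]
    simpa using this
  refine h.of_merge hb.1 hb'.1 hne {x} (fun y hy e he hye => ?_) ⟨x, hb.2⟩ ⟨x, hb'.2⟩ fun v => ?_
  · rw [Finset.mem_singleton] at hy
    subst hy
    have : e ∈ B.filter fun e => y ∈ bd e := by simp [he, hye]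
    simpa [hx] using this
  · have hb2 : b ∈ B.erase b' := Finset.mem_erase.mpr ⟨hne, hb.1⟩
    rw [pairDegree_eq_add_erase _ hb2, pairDegree_eq_add_erase bd hb'.1,
      pairDegree_eq_add_erase bd hb2, ← add_assoc]
    have hrest : pairDegree ((B.erase b').erase b)
        (Function.update bd b ((bd b ∪ bd b') \ {x})) v =
          pairDegree ((B.erase b').erase b) bd v := by
      unfold pairDegree
      congr 1
      refine Finset.filter_congr fun e he => ?_
      rw [Function.update_of_ne (Finset.mem_erase.mp he).1]
    rw [hrest, Function.update_self]
    gcongr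
    split_ifs with h1 h2 h3 h3 h2 h3 h3 <;> try omega
    exfalso
    obtain ⟨hv, hc⟩ := h1
    simp only [Finset.mem_sdiff, Finset.mem_union, Finset.mem_singleton] at hv
    rcases hv.1 with hv1 | hv1
    · refine h3 ⟨hv1, le_antisymm hcard ?_⟩
      rw [← Finset.card_pair hv.2]
      exact Finset.card_le_card (by simp [Finset.insert_subset_iff, hv1, hb.2])
    · exact h2 ⟨hv1, hcard'⟩

lemma HasClustering.of_three_le {L : ℕ} {B : Finset E} {bd : E → Finset V} {wt : E → ℕ}
    (hbd : ∀ b ∈ B, (bd b).Nonempty → (bd b).card = 2)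
    (hnest : ∀ b ∈ B, ∀ b' ∈ B, (bd b').Nonempty → bd b' ⊆ bd b → b = b')
    {x : V} (hx : 3 ≤ (B.filter fun b => x ∈ bd b).card)
    (hmax : ∀ y, (B.filter fun b => y ∈ bd b).card ≤ (B.filter fun b => x ∈ bd b).card)
    (hmin : ∀ b ∈ B, ∀ y ∈ bd b, 3 ≤ (B.filter fun b => y ∈ bd b).card)
    (h : HasClustering L B (fun b => bd b \ {x}) wt) : HasClustering L B bd wt := by
  refine h.of_sdiff {x} ?_
  rw [Finset.sum_singleton]
  have hbd2 : ∀ b ∈ B, (bd b).card ≤ 2 := fun b hb => by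
    rcases (bd b).eq_empty_or_nonempty with h0 | h0
    · simp [h0]
    · exact (hbd b hb h0).le
  have hpd : ∀ y, pairDegree B bd y = (B.filter fun b => y ∈ bd b).card := fun y => by
    unfold pairDegree
    congr 1
    exact Finset.filter_congr fun b hb => ⟨fun h => h.1, fun h => ⟨h, hbd b hb ⟨y, h⟩⟩⟩
  set r := (B.filter fun b => x ∈ bd b).card with hr
  have hw : (2 : ℝ) / L * activeWeight B (fun b => bd b \ {x}) wt ≤
      2 / L * activeWeight B bd wt := by
    gcongr
    exact activeWeight_sdiff_le ..
  have hother : ∀ b ∈ B, x ∈ bd b → ∃ y, y ≠ x ∧ bd b = {x, y} := fun b hb hxb => by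
    obtain ⟨u, v, huv, he⟩ := Finset.card_eq_two.mp (hbd b hb ⟨x, hxb⟩)
    rw [he, Finset.mem_insert, Finset.mem_singleton] at hxb
    rcases hxb with rfl | rfl
    · exact ⟨v, huv.symm, he⟩
    · exact ⟨u, huv, he.trans (Finset.pair_comm _ _)⟩
  have : Nonempty V := ⟨x⟩
  choose! f hf1 hf2 using hother
  set S := (B.filter fun b => x ∈ bd b).image f with hS
  have hScard : S.card = r := by
    refine Finset.card_image_of_injOn fun b hb b' hb' hff => ?_
    simp only [Finset.coe_filter, Set.mem_ofPred_eq] at hb hb'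
    refine hnest b hb.1 b' hb'.1 ⟨x, hb'.2⟩ ?_
    rw [hf2 b hb.1 hb.2, hf2 b' hb'.1 hb'.2, hff]
  have hxS : x ∉ S := by
    intro hx
    obtain ⟨b, hb, he⟩ := Finset.mem_image.mp hx
    rw [Finset.mem_filter] at hb
    exact hf1 b hb.1 hb.2 he
  have hdrop : ∀ y ∈ S, spanCost r ≤ potential r + r * (potential (pairDegree B bd y) -
      potential (pairDegree B (fun b => bd b \ {x}) y)) := by
    intro y hy
    obtain ⟨b, hb, rfl⟩ := Finset.mem_image.mp hy
    rw [Finset.mem_filter] at hb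
    have hyb : f b ∈ bd b := by rw [hf2 b hb.1 hb.2]; simp
    have h1 : pairDegree B (fun b => bd b \ {x}) (f b) ≤ pairDegree B bd (f b) - 1 := by
      apply Nat.le_sub_one_of_lt
      refine Finset.card_lt_card (Finset.ssubset_iff_of_subset (fun e he => ?_) |>.mpr ⟨b, ?_, ?_⟩)
      · simp only [Finset.mem_filter, Finset.mem_sdiff] at he ⊢
        exact ⟨he.1, he.2.1.1, hbd e he.1 ⟨_, he.2.1.1⟩⟩
      · simp only [Finset.mem_filter]
        exact ⟨hb.1, hyb, hbd b hb.1 ⟨_, hyb⟩⟩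
      · simp only [Finset.mem_filter, not_and]
        intro _ _ h2
        have h3 := Finset.card_sdiff_add_card_eq_card
          (Finset.singleton_subset_iff.mpr hb.2 : {x} ⊆ bd b)
        rw [h2, hbd b hb.1 ⟨_, hyb⟩] at h3
        simp at h3
    have h2 := potential_mono h1
    have h3 := spanCost_le_potential_of_le (j := pairDegree B bd (f b)) (r := r)
      (by rw [hpd]; exact hmin b hb.1 _ hyb) (by rw [hpd]; exact hmax _)
    refine h3.trans ?_
    gcongr
  have hpx : pairDegree B (fun b => bd b \ {x}) x = 0 :=
    pairDegree_sdiff_eq_zero B bd (Finset.mem_singleton_self x)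
  have hr0 : (0 : ℝ) < r := by exact_mod_cast (by omega : 0 < r)
  have hsum : spanCost r - potential r ≤ ∑ y ∈ S, (potential (pairDegree B bd y) -
      potential (pairDegree B (fun b => bd b \ {x}) y)) := by
    have : ∑ y ∈ S, (spanCost r - potential r) / r ≤ ∑ y ∈ S, (potential (pairDegree B bd y) -
        potential (pairDegree B (fun b => bd b \ {x}) y)) := by
      refine Finset.sum_le_sum fun y hy => ?_
      rw [div_le_iff₀ hr0]
      linarith [hdrop y hy]
    rwa [Finset.sum_const, hScard, nsmul_eq_mul, mul_div_cancel₀ _ hr0.ne'] at this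
  have htot : ∑ y ∈ insert x S, (potential (pairDegree B bd y) -
      potential (pairDegree B (fun b => bd b \ {x}) y)) ≤ ∑ y, (potential (pairDegree B bd y) -
      potential (pairDegree B (fun b => bd b \ {x}) y)) :=
    Finset.sum_le_sum_of_subset_of_nonneg (Finset.subset_univ _) fun y _ _ =>
      sub_nonneg.mpr (potential_mono (pairDegree_sdiff_le B hbd2 _ y))
  rw [Finset.sum_insert hxS, hpx, potential_zero, hpd x, ← hr, sub_zero] at htot
  have hdist := Finset.sum_sub_distrib (s := Finset.univ) (fun y => potential (pairDegree B bd y))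
    (fun y => potential (pairDegree B (fun b => bd b \ {x}) y))
  linarith

theorem hasClustering {L : ℕ} (hL : 0 < L) (B : Finset E) (bd : E → Finset V) (wt : E → ℕ)
    (hbd : ∀ b ∈ B, (bd b).card ≤ 2) (hwt : ∀ b ∈ B, wt b ≤ 2 * L) :
    HasClustering L B bd wt := by
  induction hm : ∑ b ∈ B, (1 + (bd b).card) using Nat.strong_induction_on
    generalizing B bd wt with
  | _ m ih =>
  subst hm
  have delete (D : Finset V) (b : E) (hb : b ∈ B) (hD : (bd b ∩ D).Nonempty) :
      HasClustering L B (fun b => bd b \ D) wt := by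
    refine ih _ ?_ B _ wt (fun e he => (Finset.card_le_card Finset.sdiff_subset).trans (hbd e he))
      hwt rfl
    refine Finset.sum_lt_sum (fun e _ => by gcongr; exact Finset.sdiff_subset) ⟨b, hb, ?_⟩
    have h1 := Finset.card_sdiff_add_card_inter (bd b) D
    have h2 := hD.card_pos
    omega
  have merge (D : Finset V) (b b' : E) (hb : b ∈ B) (hb' : b' ∈ B) (hne : b ≠ b')
      (hw : wt b ≤ L) (hw' : wt b' ≤ L) (hc : ((bd b ∪ bd b') \ D).card ≤ 2) :
      HasClustering L (B.erase b') (Function.update bd b ((bd b ∪ bd b') \ D))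
        (Function.update wt b (wt b + wt b')) := by
    refine ih _ ?_ _ _ _ (fun e he => ?_) (fun e he => ?_) rfl
    · have hb2 : b ∈ B.erase b' := Finset.mem_erase.mpr ⟨hne, hb⟩
      rw [← Finset.add_sum_erase _ _ hb2, ← Finset.add_sum_erase B _ hb',
        ← Finset.add_sum_erase _ _ hb2, ← add_assoc, Function.update_self]
      refine add_lt_add_of_lt_of_le ?_ (le_of_eq (Finset.sum_congr rfl fun e he => ?_))
      · have h1 := Finset.card_le_card (Finset.sdiff_subset (s := bd b ∪ bd b') (t := D))
        have h2 := Finset.card_union_le (bd b) (bd b')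
        omega
      · rw [Function.update_of_ne (Finset.mem_erase.mp he).1]
    · by_cases h : e = b
      · subst h
        rwa [Function.update_self]
      · rw [Function.update_of_ne h]
        exact hbd e (Finset.mem_of_mem_erase he)
    · by_cases h : e = b
      · subst h
        rw [Function.update_self]
        omega
      · rw [Function.update_of_ne h]
        exact hwt e (Finset.mem_of_mem_erase he)
  by_cases hact : ∀ b ∈ B, bd b = ∅
  · exact hasClustering_of_forall_eq_empty hwt hact
  push Not at hact
  obtain ⟨b₀, hb₀, hne₀⟩ := hact
  by_cases hheavy : ∃ b ∈ B, (bd b).Nonempty ∧ L < wt b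
  · obtain ⟨b, hb, hne, hw⟩ := hheavy
    exact .of_heavy hL hbd hb hne hw (delete _ b hb (by simpa using hne))
  push Not at hheavy
  by_cases hnest : ∃ b ∈ B, ∃ b' ∈ B, (bd b').Nonempty ∧ bd b' ⊆ bd b ∧ b ≠ b'
  · obtain ⟨b, hb, b', hb', hne', hsub, hne⟩ := hnest
    refine .of_nested hb hb' hne hne' hsub (merge ∅ b b' hb hb' hne
      (hheavy b hb (hne'.mono hsub)) (hheavy b' hb' hne') ?_)
    rw [Finset.sdiff_empty, Finset.union_eq_left.mpr hsub]
    exact hbd b hb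
  push Not at hnest
  by_cases hone : ∃ b ∈ B, ∃ x ∈ bd b, (B.filter fun b => x ∈ bd b).card ≤ 1
  · obtain ⟨b, hb, x, hx, hc⟩ := hone
    refine (delete {x} b hb ⟨x, by simp [hx]⟩).of_sdiff {x} ?_
    rw [Finset.sum_singleton]
    have h1 := spanCost_mono hc
    rw [spanCost_one] at h1
    have h2 : ∑ y, potential (pairDegree B (fun b => bd b \ {x}) y) ≤
        ∑ y, potential (pairDegree B bd y) :=
      Finset.sum_le_sum fun y _ => potential_mono (pairDegree_sdiff_le B hbd _ y)
    have h3 : (2 : ℝ) / L * activeWeight B (fun b => bd b \ {x}) wt ≤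
        2 / L * activeWeight B bd wt := by
      gcongr
      exact activeWeight_sdiff_le ..
    linarith
  push Not at hone
  have hpair : ∀ b ∈ B, (bd b).Nonempty → (bd b).card = 2 := by
    intro b hb hne
    by_contra hcon
    have hc1 : (bd b).card = 1 := by
      have := hbd b hb
      have := hne.card_pos
      omega
    obtain ⟨x, hx⟩ := Finset.card_eq_one.mp hc1
    obtain ⟨e, he, heb⟩ := Finset.exists_mem_ne (hone b hb x (by simp [hx])) b
    rw [Finset.mem_filter] at he
    exact heb (hnest e he.1 b hb hne (by simpa [hx] using he.2))
  by_cases htwo : ∃ x, (B.filter fun b => x ∈ bd b).card = 2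
  · obtain ⟨x, hx⟩ := htwo
    obtain ⟨b, b', hne, hxe⟩ := Finset.card_eq_two.mp hx
    have hb : b ∈ B ∧ x ∈ bd b := by
      have : b ∈ B.filter fun e => x ∈ bd e := by simp [hxe]
      simpa using this
    have hb' : b' ∈ B ∧ x ∈ bd b' := by
      have : b' ∈ B.filter fun e => x ∈ bd e := by simp [hxe]
      simpa using this
    refine .of_card_eq_two hne hxe (hbd b hb.1) (hpair b' hb'.1 ⟨x, hb'.2⟩)
      (merge {x} b b' hb.1 hb'.1 hne (hheavy b hb.1 ⟨x, hb.2⟩) (hheavy b' hb'.1 ⟨x, hb'.2⟩) ?_)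
    have h1 := Finset.card_union_add_card_inter (bd b) (bd b')
    have h2 : 0 < (bd b ∩ bd b').card :=
      Finset.card_pos.mpr ⟨x, Finset.mem_inter.mpr ⟨hb.2, hb'.2⟩⟩
    have h3 := Finset.card_sdiff_add_card_eq_card
      (show {x} ⊆ bd b ∪ bd b' by simp [hb.2])
    have h4 := hbd b hb.1
    have h5 := hbd b' hb'.1
    rw [Finset.card_singleton] at h3
    omega
  push Not at htwo
  have hmin : ∀ b ∈ B, ∀ y ∈ bd b, 3 ≤ (B.filter fun b => y ∈ bd b).card := fun b hb y hy => by
    have h1 := hone b hb y hy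
    have h2 := htwo y
    omega
  obtain ⟨x₀, hx₀⟩ := hne₀
  obtain ⟨x, -, hmax⟩ := Finset.exists_max_image Finset.univ
    (fun y => (B.filter fun b => y ∈ bd b).card) ⟨x₀, Finset.mem_univ _⟩
  have hx3 := (hmin b₀ hb₀ x₀ hx₀).trans (hmax x₀ (Finset.mem_univ _))
  obtain ⟨b, hb⟩ := Finset.card_pos.mp (show 0 < (B.filter fun b => x ∈ bd b).card by omega)
  rw [Finset.mem_filter] at hb
  exact .of_three_le hpair hnest hx3 (fun y => hmax y (Finset.mem_univ _)) hmin
    (delete {x} b hb.1 ⟨x, by simp [hb.2]⟩)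

end Clustering

section Labelling

variable {V C T : Type} [Fintype V] [DecidableEq C]

lemma card_not_disjoint_le [DecidableEq V] {A A' : V → Finset C} (hsub : ∀ x, A' x ⊆ A x)
    (hA : ∀ x, (A' x).card ≤ 5) {M : ℕ} (hM : ∀ c, (Finset.univ.filter fun x => c ∈ A x).card ≤ M) :
    (Finset.univ.filter fun p : V × V => ¬ Disjoint (A' p.1) (A' p.2)).card ≤
      5 * M * Fintype.card V := by
  calc _ ≤ (Finset.univ.biUnion fun x => (A' x).biUnion fun c =>
        (Finset.univ.filter fun y => c ∈ A y).image fun y => (x, y)).card := by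
        refine Finset.card_le_card fun p hp => ?_
        simp only [Finset.mem_filter, Finset.mem_univ, true_and, Finset.not_disjoint_iff] at hp
        obtain ⟨c, h1, h2⟩ := hp
        simp only [Finset.mem_biUnion, Finset.mem_image, Finset.mem_filter, Finset.mem_univ,
          true_and]
        exact ⟨p.1, c, h1, p.2, hsub _ h2, rfl⟩
    _ ≤ ∑ x : V, 5 * M := by
        refine Finset.card_biUnion_le.trans (Finset.sum_le_sum fun x _ => ?_)
        refine Finset.card_biUnion_le.trans ?_
        calc _ ≤ ∑ c ∈ A' x, M :=
              Finset.sum_le_sum fun c _ => Finset.card_image_le.trans (hM c)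
          _ = (A' x).card * M := by simp
          _ ≤ 5 * M := Nat.mul_le_mul_right _ (hA x)
    _ = _ := by simp [mul_comm]

variable [Fintype C] [Fintype T]

lemma card_mul_sum_mul_of_dependsOn {A A' : Finset C} (h : Disjoint A A') {f g : (C → T) → ℝ}
    (hf : DependsOn f (A : Set C)) (hg : DependsOn g (A' : Set C)) :
    (Fintype.card (C → T) : ℝ) * ∑ ω, f ω * g ω = (∑ ω, f ω) * ∑ ω, g ω := by
  let e : (C → T) × (C → T) → (C → T) × (C → T) :=
    fun p => (A.piecewise p.1 p.2, A.piecewise p.2 p.1)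
  have he : Function.Involutive e := fun p => by
    ext c <;> by_cases hc : c ∈ A <;> simp [e, hc]
  have h1 : ∑ p : (C → T) × (C → T), f (e p).1 * g (e p).1 =
      ∑ p : (C → T) × (C → T), f p.1 * g p.1 :=
    Equiv.sum_comp he.toPerm fun p : (C → T) × (C → T) => f p.1 * g p.1
  have h2 : ∀ p, f (e p).1 * g (e p).1 = f p.1 * g p.2 := fun p => by
    congr 1
    · exact hf fun c hc => by simp [e, Finset.mem_coe.mp hc]
    · exact hg fun c hc => by simp [e, Finset.disjoint_right.mp h (Finset.mem_coe.mp hc)]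
  simp only [h2] at h1
  rw [Finset.sum_mul_sum, ← Finset.sum_product', Finset.univ_product_univ, h1,
    ← Finset.univ_product_univ, Finset.sum_product]
  simp [Finset.mul_sum]

lemma sum_sq_sum_sub_le [DecidableEq V] {A : V → Finset C} {f : V → (C → T) → ℝ}
    (hf : ∀ x, DependsOn (f x) (A x : Set C)) {μ : V → ℝ}
    (hμ : ∀ x, ∑ ω, f x ω = Fintype.card (C → T) * μ x) (hb : ∀ x ω, |f x ω - μ x| ≤ 1) {D : ℕ}
    (hD : (Finset.univ.filter fun p : V × V => ¬ Disjoint (A p.1) (A p.2)).card ≤ D) :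
    ∑ ω, (∑ x, (f x ω - μ x)) ^ 2 ≤ D * Fintype.card (C → T) := by
  have h1 : ∑ ω, (∑ x, (f x ω - μ x)) ^ 2 =
      ∑ p : V × V, ∑ ω, (f p.1 ω - μ p.1) * (f p.2 ω - μ p.2) := by
    rw [Finset.sum_comm]
    refine Finset.sum_congr rfl fun ω _ => ?_
    rw [sq, Finset.sum_mul_sum, ← Finset.sum_product', Finset.univ_product_univ]
  have h2 : ∀ p : V × V, ∑ ω, (f p.1 ω - μ p.1) * (f p.2 ω - μ p.2) ≤
      if ¬ Disjoint (A p.1) (A p.2) then (Fintype.card (C → T) : ℝ) else 0 := by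
    intro p
    split_ifs with hp
    · have h3 := card_mul_sum_mul_of_dependsOn hp
        (f := fun ω => f p.1 ω - μ p.1) (g := fun ω => f p.2 ω - μ p.2)
        (fun ω ω' h => by simp only [hf p.1 h]) (fun ω ω' h => by simp only [hf p.2 h])
      have h4 : ∑ ω, (f p.1 ω - μ p.1) = 0 := by
        rw [Finset.sum_sub_distrib, hμ]
        simp
      rw [h4, zero_mul, mul_eq_zero] at h3
      rcases h3 with h3 | h3
      · have : IsEmpty (C → T) := Fintype.card_eq_zero_iff.mp (by exact_mod_cast h3)
        simp
      · exact h3.le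
    · calc _ ≤ ∑ ω : C → T, (1 : ℝ) := by
            refine Finset.sum_le_sum fun ω _ => (le_abs_self _).trans ?_
            rw [abs_mul]
            exact mul_le_one₀ (hb _ _) (abs_nonneg _) (hb _ _)
        _ = _ := by simp
  rw [h1]
  refine (Finset.sum_le_sum fun p _ => h2 p).trans ?_
  rw [← Finset.sum_filter, Finset.sum_const, nsmul_eq_mul]
  gcongr

lemma card_forall_mem [DecidableEq T] [Nonempty T] (A : Finset C) (I : Finset T) :
    ((Finset.univ.filter fun ω : C → T => ∀ c ∈ A, ω c ∈ I).card : ℝ) =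
      Fintype.card (C → T) * ((I.card : ℝ) / Fintype.card T) ^ A.card := by
  have h1 : (Finset.univ.filter fun ω : C → T => ∀ c ∈ A, ω c ∈ I) =
      Fintype.piFinset fun c => if c ∈ A then I else Finset.univ := by
    ext ω
    simp only [Finset.mem_filter, Finset.mem_univ, true_and, Fintype.mem_piFinset]
    refine forall_congr' fun c => ?_
    split_ifs with h <;> simp [h]
  have h2 : (Fintype.card T : ℝ) ≠ 0 := by exact_mod_cast Fintype.card_ne_zero
  rw [h1, Fintype.card_piFinset, Fintype.card_fun]
  push_cast
  have h3 : ∀ c, ((if c ∈ A then I else Finset.univ).card : ℝ) =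
      Fintype.card T * if c ∈ A then (I.card : ℝ) / Fintype.card T else 1 := fun c => by
    split_ifs
    · field_simp
    · simp
  rw [Finset.prod_congr rfl fun c _ => h3 c, Finset.prod_mul_distrib, Finset.prod_const,
    Finset.prod_ite_mem, Finset.univ_inter, Finset.prod_const, Finset.card_univ]

/-- Some pair of labels of elements of `A` encloses `l`. -/
def Encloses {N : ℕ} (A : Finset C) (l : Fin N) (ω : C → Fin N) : Prop :=
  ∃ c ∈ A, ∃ c' ∈ A, ω c ≤ l ∧ l ≤ ω c'

lemma pow_add_pow_ge {N : ℕ} {α β : ℝ} (hα : 0 ≤ α) (hβ : 0 ≤ β) (hN : 0 < N)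
    (h : α + β = 1 - 1 / N) {j : ℕ} (hj : 1 ≤ j) (hj' : j ≤ 5) :
    1 - α ^ j - β ^ j ≤ spanCost j + 1 / N := by
  obtain ⟨n, rfl⟩ : ∃ n, j = n + 1 := ⟨j - 1, by omega⟩
  have hN' : (1 : ℝ) ≤ N := by exact_mod_cast hN
  have hinv : 1 / (N : ℝ) ≤ 1 := by rw [div_le_one (by linarith)]; exact hN'
  have h1 := add_pow_le hα hβ (n + 1)
  have h2 := one_add_mul_le_pow (a := -(1 / (N : ℝ))) (by linarith) (n + 1)
  have h3 : 1 + -(1 / (N : ℝ)) = α + β := by linarith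
  rw [h3] at h2
  have h4 : spanCost (n + 1) = 1 - 1 / 2 ^ n := by
    unfold spanCost
    rw [if_neg (by omega), if_pos hj', pow_succ]
    field_simp
  rw [Nat.add_sub_cancel] at h1
  have h5 : (n : ℝ) + 1 ≤ 2 ^ n := by exact_mod_cast Nat.lt_two_pow_self
  have h6 : (0 : ℝ) ≤ 1 / N := by positivity
  have h7 : ((n : ℝ) + 1) * (1 / N) ≤ 2 ^ n * (1 / N) := by gcongr
  have h8 : (0 : ℝ) < 2 ^ n := by positivity
  have h9 : 2 ^ n * (1 / 2 ^ n - 1 / (N : ℝ)) ≤ 2 ^ n * (α ^ (n + 1) + β ^ (n + 1)) := by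
    have : (2 : ℝ) ^ n * (1 / 2 ^ n) = 1 := by field_simp
    rw [mul_sub, this]
    push_cast at h2
    linarith
  have := le_of_mul_le_mul_left h9 h8
  rw [h4]
  linarith

open Classical in
lemma card_encloses_le {N : ℕ} (A : Finset C) (hA : A.card ≤ 5) (l : Fin N) :
    ((Finset.univ.filter fun ω : C → Fin N => Encloses A l ω).card : ℝ) ≤
      Fintype.card (C → Fin N) * (spanCost A.card + 1 / N) := by
  have hN : 0 < N := l.pos
  have : NeZero N := ⟨hN.ne'⟩
  rcases A.eq_empty_or_nonempty with rfl | hne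
  · simp only [Encloses, Finset.notMem_empty, false_and, exists_false, Finset.filter_false,
      Finset.card_empty, Nat.cast_zero, spanCost_zero, zero_add]
    positivity
  set U := Finset.univ.filter fun ω : C → Fin N => ∀ c ∈ A, ω c ∈ Finset.Iio l with hU
  set W := Finset.univ.filter fun ω : C → Fin N => ∀ c ∈ A, ω c ∈ Finset.Ioi l with hW
  set X := Finset.univ.filter fun ω : C → Fin N => Encloses A l ω with hX
  have hUW : Disjoint U W := by
    rw [Finset.disjoint_left]
    intro ω h1 h2
    obtain ⟨c, hc⟩ := hne
    simp only [hU, hW, Finset.mem_filter, Finset.mem_univ, true_and, Finset.mem_Iio,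
      Finset.mem_Ioi] at h1 h2
    exact lt_asymm (h1 c hc) (h2 c hc)
  have hXUW : Disjoint X (U ∪ W) := by
    rw [Finset.disjoint_left]
    intro ω h1 h2
    simp only [hU, hW, hX, Finset.mem_filter, Finset.mem_univ, true_and, Finset.mem_Iio,
      Finset.mem_Ioi, Finset.mem_union] at h1 h2
    obtain ⟨c, hc, c', hc', h3, h4⟩ := h1
    rcases h2 with h2 | h2
    · exact absurd (h2 c' hc') (not_lt.mpr h4)
    · exact absurd (h2 c hc) (not_lt.mpr h3)
  have hcard : X.card + (U.card + W.card) ≤ Fintype.card (C → Fin N) := by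
    rw [← Finset.card_union_of_disjoint hUW, ← Finset.card_union_of_disjoint hXUW]
    exact Finset.card_le_univ _
  have hcard' : (X.card : ℝ) + (U.card + W.card) ≤ Fintype.card (C → Fin N) := by
    exact_mod_cast hcard
  have hl : ((N - 1 - (l : ℕ) : ℕ) : ℝ) = N - 1 - l := by
    have := l.isLt
    rw [Nat.cast_sub (by omega), Nat.cast_sub (by omega)]
    simp
  have hN' : (0 : ℝ) < N := by exact_mod_cast hN
  have hpow := pow_add_pow_ge (N := N) (α := (l : ℕ) / N) (β := ((N - 1 - (l : ℕ) : ℕ) : ℝ) / N)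
    (by positivity) (by positivity) hN (by rw [hl]; field_simp; ring) hne.card_pos hA
  rw [hU, hW, card_forall_mem, card_forall_mem, Fin.card_Iio, Fin.card_Ioi, Fintype.card_fin]
    at hcard'
  have := mul_le_mul_of_nonneg_left hpow (Nat.cast_nonneg (α := ℝ) (Fintype.card (C → Fin N)))
  rw [mul_sub, mul_sub, mul_one] at this
  linarith

open Classical in
theorem exists_labelling (A : V → Finset C) {M : ℕ}
    (hM : ∀ c, (Finset.univ.filter fun x => c ∈ A x).card ≤ M) {N : ℕ} (hN : 0 < N) {δ : ℝ}
    (hδ : 0 ≤ δ) (hbig : (N : ℝ) * (5 * M * Fintype.card V) < δ ^ 2) :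
    ∃ ω : C → Fin N, ∀ l, ((Finset.univ.filter fun x => Encloses (A x) l ω).card : ℝ) ≤
      ∑ x, spanCost (A x).card + Fintype.card V / N + δ := by
  have : NeZero N := ⟨hN.ne'⟩
  set Ω := (Fintype.card (C → Fin N) : ℝ) with hΩ
  have hΩ0 : 0 < Ω := by
    rw [hΩ]
    exact_mod_cast Fintype.card_pos
  let A' : V → Finset C := fun x => if (A x).card ≤ 5 then A x else ∅
  let f : Fin N → V → (C → Fin N) → ℝ := fun l x ω =>
    if (A x).card ≤ 5 then (if Encloses (A x) l ω then 1 else 0) else 1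
  let μ : Fin N → V → ℝ := fun l x => (∑ ω, f l x ω) / Ω
  have hμ : ∀ l x, ∑ ω, f l x ω = Ω * μ l x := fun l x => by
    simp only [μ]
    field_simp
  have hf0 : ∀ l x ω, 0 ≤ f l x ω := fun l x ω => by
    simp only [f]
    split_ifs <;> norm_num
  have hf1 : ∀ l x ω, f l x ω ≤ 1 := fun l x ω => by
    simp only [f]
    split_ifs <;> norm_num
  have hμ0 : ∀ l x, 0 ≤ μ l x := fun l x =>
    div_nonneg (Finset.sum_nonneg fun ω _ => hf0 l x ω) hΩ0.le
  have hμ1 : ∀ l x, μ l x ≤ 1 := fun l x => by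
    rw [div_le_one hΩ0]
    refine (Finset.sum_le_sum fun ω _ => hf1 l x ω).trans (by simp [hΩ])
  have hμs : ∀ l x, μ l x ≤ spanCost (A x).card + 1 / N := fun l x => by
    by_cases hx : (A x).card ≤ 5
    · rw [div_le_iff₀' hΩ0]
      simp only [f, if_pos hx, Finset.sum_boole]
      exact card_encloses_le (A x) hx l
    · refine (hμ1 l x).trans ?_
      have : spanCost (A x).card = 1 := by
        unfold spanCost
        rw [if_neg (by omega), if_neg hx]
      rw [this]
      have : (0 : ℝ) ≤ 1 / N := by positivity
      linarith
  have hdep : ∀ l x, DependsOn (f l x) (A' x : Set C) := fun l x ω ω' h => by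
    simp only [f]
    split_ifs with hx h1 h2 h2
    · rfl
    · exfalso
      simp only [A', if_pos hx] at h
      obtain ⟨c, hc, c', hc', h3, h4⟩ := h1
      exact h2 ⟨c, hc, c', hc', h c hc ▸ h3, h c' hc' ▸ h4⟩
    · exfalso
      simp only [A', if_pos hx] at h
      obtain ⟨c, hc, c', hc', h3, h4⟩ := h2
      exact h1 ⟨c, hc, c', hc', (h c hc).symm ▸ h3, (h c' hc').symm ▸ h4⟩
    · rfl
    · rfl
  have hpairs := card_not_disjoint_le (A := A) (A' := A')
    (fun x => by simp only [A']; split_ifs <;> simp)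
    (fun x => by simp only [A']; split_ifs with h <;> simp [h]) hM
  have hvar : ∀ l, ∑ ω, (∑ x, (f l x ω - μ l x)) ^ 2 ≤ (5 * M * Fintype.card V : ℕ) * Ω :=
    fun l => sum_sq_sum_sub_le (hdep l) (hμ l) (fun x ω => by
      rw [abs_le]
      constructor <;> linarith [hf0 l x ω, hf1 l x ω, hμ0 l x, hμ1 l x]) hpairs
  obtain ⟨ω, hω⟩ : ∃ ω : C → Fin N, ∀ l, ∑ x, (f l x ω - μ l x) ≤ δ := by
    by_contra! hcon
    have h1 : ∀ ω : C → Fin N, δ ^ 2 ≤ ∑ l, (∑ x, (f l x ω - μ l x)) ^ 2 := fun ω => by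
      obtain ⟨l, hl⟩ := hcon ω
      refine le_trans ?_ (Finset.single_le_sum (fun l _ => sq_nonneg _) (Finset.mem_univ l))
      gcongr
    have h2 := Finset.sum_le_sum fun ω (_ : ω ∈ Finset.univ) => h1 ω
    rw [Finset.sum_comm] at h2
    have h3 := h2.trans (Finset.sum_le_sum fun l _ => hvar l)
    simp only [Finset.sum_const, Finset.card_univ, nsmul_eq_mul, Fintype.card_fin, ← hΩ] at h3
    push_cast at h3
    nlinarith
  refine ⟨ω, fun l => ?_⟩
  have h1 : ((Finset.univ.filter fun x => Encloses (A x) l ω).card : ℝ) ≤ ∑ x, f l x ω := by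
    rw [← Finset.sum_boole]
    refine Finset.sum_le_sum fun x _ => ?_
    simp only [f]
    split_ifs <;> norm_num
  have h2 := hω l
  rw [Finset.sum_sub_distrib] at h2
  have h3 := Finset.sum_le_sum fun x (_ : x ∈ Finset.univ) => hμs l x
  rw [Finset.sum_add_distrib] at h3
  simp only [Finset.sum_const, Finset.card_univ, nsmul_eq_mul] at h3
  rw [mul_one_div] at h3
  linarith

end Labelling

lemma Sym2.count_toMul_mk {V : Type} [DecidableEq V] (u v x : V) :
    Multiset.count x (s(u, v) : Sym2 V).toMul = (if u = x then 1 else 0) + if v = x then 1 else 0 := by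
  change Multiset.count x {u, v} = _
  rw [Multiset.insert_eq_cons, Multiset.count_cons, Multiset.count_singleton, add_comm]
  simp only [eq_comm]

lemma deg_cycleQuotEnds (k c : ℕ) (g : Fin k → Fin c) (v : Fin c) :
    Multigraph.deg (cycleQuotEnds k c g) v = 2 * (Finset.univ.filter fun j => g j = v).card := by
  unfold Multigraph.deg cycleQuotEnds
  simp only [Sym2.count_toMul_mk]
  rw [Finset.sum_add_distrib,
    Equiv.sum_comp (finRotate k) (fun j => if g j = v then 1 else 0), Finset.card_filter, two_mul]

lemma sum_deg_cycleQuotEnds (k c : ℕ) (g : Fin k → Fin c) :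
    ∑ v, Multigraph.deg (cycleQuotEnds k c g) v = 2 * k := by
  simp only [deg_cycleQuotEnds]
  rw [← Finset.mul_sum, ← Finset.card_eq_sum_card_fiberwise (fun _ _ => Finset.mem_coe.mpr
    (Finset.mem_univ _)), Finset.card_univ, Fintype.card_fin]

lemma pairDegree_toFinset_le_deg {V E : Type} [DecidableEq V] [Fintype E] (ends : E → Sym2 V)
    (v : V) : pairDegree Finset.univ (fun e => (ends e).toFinset) v ≤ Multigraph.deg ends v := by
  unfold pairDegree Multigraph.deg
  rw [Finset.card_filter]
  refine Finset.sum_le_sum fun e _ => ?_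
  beta_reduce
  generalize ends e = s
  induction s using Sym2.inductionOn with
  | _ a b =>
  rw [Sym2.count_toMul_mk]
  simp only [Sym2.mem_toFinset, Sym2.mem_iff]
  grind

lemma card_toFinset_le_two {V : Type} [DecidableEq V] (e : Sym2 V) : e.toFinset.card ≤ 2 := by
  rw [Sym2.card_toFinset]
  split_ifs <;> norm_num

theorem pathwidth_le_of_labelling {V E : Type} [Fintype V] [DecidableEq V] [Fintype E]
    [DecidableEq E] {ends : E → Sym2 V} (hinc : ∀ v, ∃ e, v ∈ ends e) (a : E → E) {n : ℕ}
    (ω : E → Fin (n + 1)) {R : ℝ} (hR : 0 ≤ R) (h : ∀ l (S : Finset V), (∀ x ∈ S,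
      Encloses (clustersAt Finset.univ (fun e => (ends e).toFinset) a x) l ω) → (S.card : ℝ) ≤ R) :
    (Multigraph.pathwidth ends : ℝ) ≤ R := by
  classical
  have hmem : ∀ e v, v ∈ ends e →
      a e ∈ clustersAt Finset.univ (fun e => (ends e).toFinset) a v := fun e v hv =>
    Finset.mem_image_of_mem _ (by simpa using hv)
  suffices hpw : Multigraph.pathwidth ends ≤ ⌊R⌋₊ from (Nat.le_floor_iff hR).mp hpw
  refine Nat.sInf_le ⟨n, fun l => Finset.univ.filter fun x =>
    Encloses (clustersAt Finset.univ (fun e => (ends e).toFinset) a x) l ω,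
    ⟨fun v => ?_, fun v l₁ l₂ l₃ h₁₂ h₂₃ h₁ h₃ => ?_, fun e => ?_⟩, fun l => ?_⟩
  · obtain ⟨e, he⟩ := hinc v
    exact ⟨ω (a e), Finset.mem_filter.mpr ⟨Finset.mem_univ _, a e, hmem e v he, a e,
      hmem e v he, le_rfl, le_rfl⟩⟩
  · simp only [Finset.mem_filter, Finset.mem_univ, true_and] at h₁ h₃ ⊢
    obtain ⟨c, hc, -, -, hcl, -⟩ := h₁
    obtain ⟨-, -, c', hc', -, hcl'⟩ := h₃
    exact ⟨c, hc, c', hc', hcl.trans h₁₂, h₂₃.trans hcl'⟩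
  · exact ⟨ω (a e), fun u hu => Finset.mem_filter.mpr ⟨Finset.mem_univ _, a e, hmem e u hu, a e,
      hmem e u hu, le_rfl, le_rfl⟩⟩
  · refine Nat.le_succ_of_le (Nat.le_floor (h l _ fun x hx => (Finset.mem_filter.mp hx).2))

theorem pathwidth_le_of_even {V E : Type} [Fintype V] [DecidableEq V] [Fintype E] [DecidableEq E]
    {ends : E → Sym2 V} (hinc : ∀ v, ∃ e, v ∈ ends e) (heven : ∀ v, Even (Multigraph.deg ends v))
    {L N : ℕ} (hL : 0 < L) (hN : 0 < N) {δ : ℝ} (hδ : 0 ≤ δ)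
    (hbig : (N : ℝ) * (20 * L * Fintype.card V) < δ ^ 2) :
    (Multigraph.pathwidth ends : ℝ) ≤ 23 / 270 * ∑ v, (Multigraph.deg ends v : ℝ) +
      2 / L * Fintype.card E + Fintype.card V / N + δ := by
  classical
  obtain ⟨n, rfl⟩ : ∃ n, N = n + 1 := ⟨N - 1, by omega⟩
  obtain ⟨a, ha, hcost⟩ := hasClustering hL Finset.univ (fun e => (ends e).toFinset) (fun _ => 1)
    (fun e _ => card_toFinset_le_two _) (fun _ _ => by omega)
  have hmult : ∀ c, (Finset.univ.filter fun x =>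
      c ∈ clustersAt Finset.univ (fun e => (ends e).toFinset) a x).card ≤ 4 * L := fun c => by
    calc _ ≤ ((Finset.univ.filter fun e => a e = c).biUnion fun e => (ends e).toFinset).card := by
          refine Finset.card_le_card fun x hx => ?_
          simp only [clustersAt, Finset.mem_filter, Finset.mem_univ, true_and,
            Finset.mem_image] at hx
          obtain ⟨e, h1, h2⟩ := hx
          exact Finset.mem_biUnion.mpr ⟨e, by simpa using h2, h1⟩
      _ ≤ ∑ e with a e = c, 2 :=
          Finset.card_biUnion_le.trans (Finset.sum_le_sum fun e _ => card_toFinset_le_two _)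
      _ = 2 * ∑ e, (if a e = c then 1 else 0) := by
          rw [Finset.sum_const, Finset.card_filter, smul_eq_mul, mul_comm]
      _ ≤ 4 * L := by
          have := ha c
          beta_reduce at this
          omega
  obtain ⟨ω, hω⟩ := exists_labelling _ hmult (Nat.succ_pos n) hδ
    (by refine lt_of_eq_of_lt ?_ hbig; push_cast; ring)
  have hact : activeWeight Finset.univ (fun e => (ends e).toFinset) (fun _ => 1) ≤
      Fintype.card E := by
    unfold activeWeight
    rw [← Finset.card_filter]
    exact Finset.card_le_univ _
  have hact' : (2 : ℝ) / L *
      activeWeight Finset.univ (fun e => (ends e).toFinset) (fun _ => 1) ≤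
      2 / L * Fintype.card E := by gcongr
  have hpot : ∑ v, potential (pairDegree Finset.univ (fun e => (ends e).toFinset) v) ≤
      23 / 270 * ∑ v, (Multigraph.deg ends v : ℝ) := by
    rw [Finset.mul_sum]
    exact Finset.sum_le_sum fun v _ =>
      (potential_mono (pairDegree_toFinset_le_deg ends v)).trans (potential_le_of_even (heven v))
  refine pathwidth_le_of_labelling hinc a ω (by positivity) fun l S hS => ?_
  have hle : (S.card : ℝ) ≤ _ := le_trans (by
    gcongr
    exact fun x hx => Finset.mem_filter.mpr ⟨Finset.mem_univ _, hS x hx⟩) (hω l)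
  linarith

/-- For any partition of `[k]` into nonempty parts (given by a surjective identification
map `g : Fin k → Fin c`), the multigraph obtained from the cycle on `[k]` by identifying
the vertices within each part is an even multigraph with exactly `k` edges; consequently,
for every `ε > 0` and all sufficiently large `k` its pathwidth is at most
`(23/135 + ε)·k`. -/
theorem cycle_quotient_even_and_pathwidth :
    (∀ (k c : ℕ) (g : Fin k → Fin c), Function.Surjective g →
      (∀ v : Fin c, Even (Multigraph.deg (cycleQuotEnds k c g) v)) ∧
      Fintype.card (Fin k) = k) ∧
    (∀ ε : ℝ, 0 < ε → ∃ k₀ : ℕ, ∀ k : ℕ, k₀ < k →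
      ∀ (c : ℕ) (g : Fin k → Fin c), Function.Surjective g →
        (Multigraph.pathwidth (cycleQuotEnds k c g) : ℝ) ≤ (23 / 135 + ε) * (k : ℝ)) := by
  have heven : ∀ (k c : ℕ) (g : Fin k → Fin c) (v : Fin c),
      Even (Multigraph.deg (cycleQuotEnds k c g) v) := fun k c g v => by
    rw [deg_cycleQuotEnds]
    exact even_two_mul _
  refine ⟨fun k c g _ => ⟨heven k c g, Fintype.card_fin k⟩, fun ε hε => ?_⟩
  obtain ⟨L, hL⟩ := exists_nat_gt (6 / ε)
  have hL0 : (0 : ℝ) < L := lt_trans (by positivity) hL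
  obtain ⟨k₀, hk₀⟩ := exists_nat_gt (L * (20 * L) / (ε / 3) ^ 2)
  refine ⟨k₀, fun k hk c g hg => ?_⟩
  have hck : (c : ℝ) ≤ k := by
    have := Fintype.card_le_of_surjective g hg
    simp only [Fintype.card_fin] at this
    exact_mod_cast this
  have hk' : (k₀ : ℝ) < k := by exact_mod_cast hk
  have hk0 : (0 : ℝ) < k := lt_of_le_of_lt (Nat.cast_nonneg _) hk'
  have hbig : (L : ℝ) * (20 * L * Fintype.card (Fin c)) < (ε / 3 * k) ^ 2 := by
    have h1 := hk₀.trans hk'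
    rw [div_lt_iff₀ (by positivity)] at h1
    rw [Fintype.card_fin]
    calc (L : ℝ) * (20 * L * c) ≤ L * (20 * L) * k := by
          rw [← mul_assoc]
          gcongr
      _ < k * (ε / 3) ^ 2 * k := by gcongr
      _ = _ := by ring
  have hL1 : 0 < L := by exact_mod_cast hL0
  have hmain := pathwidth_le_of_even (ends := cycleQuotEnds k c g)
    (fun v => by
      obtain ⟨j, hj⟩ := hg v
      exact ⟨j, hj ▸ Sym2.mem_mk_left _ _⟩)
    (heven k c g) hL1 hL1 (δ := ε / 3 * k) (by positivity) hbig
  rw [← Nat.cast_sum, sum_deg_cycleQuotEnds, Fintype.card_fin, Fintype.card_fin] at hmain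
  have h2 : 6 / L < ε := by
    rw [div_lt_iff₀ hε] at hL
    rw [div_lt_iff₀ hL0]
    linarith
  have h3 : 2 / L * (k : ℝ) + c / L ≤ ε / 2 * k := by
    calc 2 / L * (k : ℝ) + c / L ≤ 2 / L * (k : ℝ) + k / L := by gcongr
      _ = 6 / L * (k / 2) := by ring
      _ ≤ ε * (k / 2) := by gcongr
      _ = _ := by ring
  push_cast at hmain
  have h4 : 0 ≤ ε * k := by positivity
  linarith
end
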